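/- Let m ≥ 1, n ≥ 1 and let A_0,…,A_{2m−1}, B_0,…,B_{2n−1} be finite-dimensional complex Hilbert spaces; set H := A_0⊗⋯⊗A_{2m−1}⊗B_0⊗⋯⊗B_{2n−1}. Then the set of positive semidefinite operators on H lying in the affine span (over ℝ, inside the Hermitian operators on H) of { M⊗N : M ∈ Comb_m(A_0,…,A_{2m−1}), N ∈ Comb_n(B_0,…,B_{2n−1}) } equals the intersection ⋂_{σ∈Σ_{m,n}} K_σ over all shuffle permutations σ of the sets K_σ of shuffled deterministic (m+n)-combs. -/

import Mathlib

open Matrix Kronecker ComplexOrder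

noncomputable section

private theorem cast_pi {G : ℕ → Type} {q : ℕ} (f : ∀ j : Fin q, G j) {a b : ℕ}
    (h : a = b) (ha : a < q) (hb : b < q) :
    cast (congrArg G h) (f ⟨a, ha⟩) = f ⟨b, hb⟩ := by subst h; rfl

/-- Reinterpreting a tensor product along an equality of the number of factors. -/
def piFinCast (H : ℕ → Type) {q q' : ℕ} (h : q = q') :
    (∀ j : Fin q, H j) ≃ (∀ j : Fin q', H j) where
  toFun f j := f ⟨j, h ▸ j.isLt⟩
  invFun f j := f ⟨j, h ▸ j.isLt⟩
  left_inv f := rfl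
  right_inv f := rfl

/-- The canonical identification of `H_0 ⊗ H_1 ⊗ ⋯ ⊗ H_{k+1}` with
`H_0 ⊗ (H_1 ⊗ ⋯ ⊗ H_k) ⊗ H_{k+1}`. -/
def splitEnds (H : ℕ → Type) (k : ℕ) :
    (∀ j : Fin (k + 2), H j) ≃ (H 0 × (∀ j : Fin k, H (j + 1)) × H (k + 1)) where
  toFun f := (f ⟨0, by omega⟩, fun j => f ⟨(j : ℕ) + 1, by omega⟩, f ⟨k + 1, by omega⟩)
  invFun x j :=
    if h0 : (j : ℕ) = 0 then cast (congrArg H h0.symm) x.1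
    else if hk : (j : ℕ) = k + 1 then cast (congrArg H hk.symm) x.2.2
    else cast (congrArg H (by omega : (j : ℕ) - 1 + 1 = (j : ℕ)))
      (x.2.1 ⟨(j : ℕ) - 1, by omega⟩)
  left_inv f := by
    funext j
    dsimp only
    split_ifs with h0 hk
    · exact cast_pi f h0.symm (by omega) (by omega)
    · exact cast_pi f hk.symm (by omega) (by omega)
    · exact cast_pi f (by omega) (by omega) (by omega)
  right_inv x := by
    obtain ⟨a, g, b⟩ := x
    refine Prod.ext ?_ (Prod.ext ?_ ?_)
    · rfl
    · funext j
      dsimp only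
      rw [dif_neg (by omega), dif_neg (by have := j.isLt; omega)]
      exact cast_eq _ (g j)
    · dsimp only
      rw [dif_neg (by omega), dif_pos rfl]
      exact cast_eq _ b


/-- Partial trace over the middle tensor factor. -/
def ptrMid {α β γ : Type*} [Fintype β] (M : Matrix (α × β × γ) (α × β × γ) ℂ) :
    Matrix (α × γ) (α × γ) ℂ :=
  fun p q => ∑ b, M (p.1, b, p.2) (q.1, b, q.2)

/-- Partial trace over the last of `k+1` tensor factors. -/
def trLast {H : ℕ → Type} [∀ j, Fintype (H j)] (k : ℕ)
    (R : Matrix (∀ j : Fin (k + 1), H j) (∀ j : Fin (k + 1), H j) ℂ) :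
    Matrix (∀ j : Fin k, H j) (∀ j : Fin k, H j) ℂ :=
  fun u v => ∑ b : H k, R (Fin.snoc u b) (Fin.snoc v b)

/-- The set of deterministic 1-combs on a pair of factors `α ⊗ β`: positive semidefinite
operators whose partial trace over `β` is the identity on `α`. -/
def comb1Set (α β : Type*) [Fintype α] [DecidableEq α] [Fintype β] :
    Set (Matrix (α × β) (α × β) ℂ) :=
  {M | M.PosSemidef ∧ (fun a a' => ∑ b, M (a, b) (a', b)) = (1 : Matrix α α ℂ)}

/-- The set `Comb_n(H_0,…,H_{2n−1})` of deterministic `n`-combs, defined recursively: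
a `1`-comb is a PSD operator `R` on `H_0⊗H_1` with `Tr_{H_1}[R] = I_{H_0}`; an `n`-comb
(`n ≥ 2`) is a PSD operator `R` on `H_0⊗⋯⊗H_{2n−1}` such that for every `(n−1)`-comb `S` on
`H_1⊗⋯⊗H_{2n−2}` the operator `Tr_{H_1⊗⋯⊗H_{2n−2}}[(I_{H_0}⊗S⊗I_{H_{2n−1}})·R]` is a
`1`-comb on `H_0⊗H_{2n−1}`.  (The value at `n = 0` is irrelevant and set to `∅`.) -/
def Comb : (n : ℕ) → (H : ℕ → Type) → [∀ j, Fintype (H j)] → [∀ j, DecidableEq (H j)] →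
    Set (Matrix (∀ j : Fin (2 * n), H j) (∀ j : Fin (2 * n), H j) ℂ)
  | 0, _, _, _ => ∅
  | 1, H, _, _ => {R | R.PosSemidef ∧ trLast 1 R = (1 : Matrix (∀ j : Fin 1, H j) (∀ j : Fin 1, H j) ℂ)}
  | (n + 2), H, _, _ =>
    {R | R.PosSemidef ∧ ∀ S ∈ Comb (n + 1) (fun m => H (m + 1)),
      ptrMid (((1 : Matrix (H 0) (H 0) ℂ) ⊗ₖ
          (S ⊗ₖ (1 : Matrix (H (2 * (n + 1) + 1)) (H (2 * (n + 1) + 1)) ℂ))) *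
        (Matrix.reindex (splitEnds H (2 * (n + 1))) (splitEnds H (2 * (n + 1))) R)) ∈
      comb1Set (H 0) (H (2 * (n + 1) + 1))}


/-- The partial trace over the first tensor factor. -/
def ptrLeft {α β : Type*} [Fintype α] (M : Matrix (α × β) (α × β) ℂ) : Matrix β β ℂ :=
  fun b b' => ∑ a, M (a, b) (a, b')

/-- The canonical identification of `H_0⊗⋯⊗H_{a+b−1}` with
`(H_0⊗⋯⊗H_{a−1}) ⊗ (H_a⊗⋯⊗H_{a+b−1})`. -/
def splitPi (a b : ℕ) (H : ℕ → Type) :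
    (∀ j : Fin (a + b), H j) ≃ ((∀ j : Fin a, H j) × (∀ j : Fin b, H (a + j))) where
  toFun f := (fun j => f (Fin.castAdd b j), fun j => f (Fin.natAdd a j))
  invFun x j :=
    if h : (j : ℕ) < a then x.1 ⟨(j : ℕ), h⟩
    else cast (congrArg H (by omega : a + ((j : ℕ) - a) = (j : ℕ)))
      (x.2 ⟨(j : ℕ) - a, by omega⟩)
  left_inv f := by
    funext j
    dsimp only
    split_ifs with h
    · rfl
    · exact cast_pi f (show a + ((j : ℕ) - a) = (j : ℕ) by omega) (by omega) j.isLt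
  right_inv x := by
    obtain ⟨u, v⟩ := x
    refine Prod.ext ?_ ?_
    · funext j
      dsimp only
      rw [dif_pos (show ((Fin.castAdd b j : Fin (a + b)) : ℕ) < a from j.isLt)]
      rfl
    · funext j
      dsimp only
      rw [dif_neg (show ¬(((Fin.natAdd a j : Fin (a + b)) : ℕ) < a) by
        simp only [Fin.coe_natAdd]; omega)]
      exact cast_pi (G := fun m => H (a + m)) v
        (show ((Fin.natAdd a j : Fin (a + b)) : ℕ) - a = (j : ℕ) by
          simp only [Fin.coe_natAdd]; omega)
        (by simp only [Fin.coe_natAdd]; omega) j.isLt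

/-- Extension of a permutation of `Fin q` to `ℕ` (fixing everything `≥ q`). -/
def extendPerm {q : ℕ} (σ : Equiv.Perm (Fin q)) : ℕ → ℕ :=
  fun i => if h : i < q then (σ ⟨i, h⟩ : ℕ) else i

/-- The canonical tensor-factor permutation: reinterpreting an element of
`H_0⊗⋯⊗H_{q−1}` as an element of `H_{σ(0)}⊗⋯⊗H_{σ(q−1)}` (the space whose `j`-th factor is
the original factor `σ(j)`). -/
def permEquiv (H : ℕ → Type) {q : ℕ} (σ : Equiv.Perm (Fin q)) :
    (∀ j : Fin q, H j) ≃ (∀ j : Fin q, H (extendPerm σ j)) :=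
  (Equiv.piCongrLeft' (fun i : Fin q => H i) σ.symm).trans
    (Equiv.piCongrRight fun j =>
      Equiv.cast (congrArg H (by simp [extendPerm] : ((σ j : Fin q) : ℕ) = extendPerm σ j)))

/-- The pairing `(k,r) ↦ 2k+r` of a tooth index and a position within the tooth. -/
def toothPairEquiv (p : ℕ) : Fin p × Fin 2 ≃ Fin (2 * p) where
  toFun x := ⟨2 * (x.1 : ℕ) + (x.2 : ℕ), by have := x.1.isLt; have := x.2.isLt; omega⟩
  invFun j := (⟨(j : ℕ) / 2, by have := j.isLt; omega⟩, ⟨(j : ℕ) % 2, by omega⟩)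
  left_inv x := by
    obtain ⟨a, r⟩ := x
    have hr := r.isLt
    refine Prod.ext (Fin.ext ?_) (Fin.ext ?_) <;> simp only [] <;> omega
  right_inv j := by
    apply Fin.ext
    simp only []
    omega

/-- The factor-level permutation induced by a permutation `σ` of teeth, placing tooth `T_i`
(the pair of factors `(2i, 2i+1)`) in tooth-position `σ(i)`:  the factor at new position
`2k+r` (`r ∈ {0,1}`) is the original factor `2·σ⁻¹(k)+r`. -/
def toothReorder {p : ℕ} (σ : Equiv.Perm (Fin p)) : Equiv.Perm (Fin (2 * p)) :=
  (toothPairEquiv p).permCongr (Equiv.prodCongr σ.symm (Equiv.refl (Fin 2)))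


/-- `K_σ` for a shuffle `σ` of the `m+n` teeth: the set of PSD operators `R` on
`A_0⊗⋯⊗A_{2m−1}⊗B_0⊗⋯⊗B_{2n−1}` (with `A_j := H_j`, `B_j := H_{2m+j}`) whose image under
the canonical tensor-factor permutation placing tooth `T_i` in tooth-position `σ(i)` is a
deterministic `(m+n)`-comb of the correspondingly reordered spaces. -/
def Kset (m n : ℕ) (H : ℕ → Type) [∀ j, Fintype (H j)] [∀ j, DecidableEq (H j)]
    (σ : Equiv.Perm (Fin (m + n))) :
    Set (Matrix (∀ j : Fin (2 * m + 2 * n), H j) (∀ j : Fin (2 * m + 2 * n), H j) ℂ) :=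
  {R | R.PosSemidef ∧
    Matrix.reindex
        ((piFinCast H (by omega : 2 * m + 2 * n = 2 * (m + n))).trans
          (permEquiv H (toothReorder σ)))
        ((piFinCast H (by omega : 2 * m + 2 * n = 2 * (m + n))).trans
          (permEquiv H (toothReorder σ))) R ∈
      Comb (m + n) (fun i => H (extendPerm (toothReorder σ) i))}

structure IsBand {Ω : Type*} (p : Ω → Ω → Ω) : Prop where
  idem : ∀ a, p a a = a
  left : ∀ a b c, p (p a b) c = p a c
  right : ∀ a b c, p a (p b c) = p a c

theorem IsBand.symm_iff {Ω : Type*} {p : Ω → Ω → Ω} (hp : IsBand p) {f g : Ω} :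
    p f g = g ↔ p g f = f := by
  constructor
  · intro h
    rw [← h, hp.left, hp.idem]
  · intro h
    rw [← h, hp.left, hp.idem]

open Classical in
/-- depolarizing map -/
def Dep {Ω : Type*} [Fintype Ω] (p : Ω → Ω → Ω) : Matrix Ω Ω ℂ →ₗ[ℂ] Matrix Ω Ω ℂ where
  toFun X := Matrix.of fun f g =>
    if p f g = g then (Fintype.card Ω : ℂ)⁻¹ * ∑ h, X (p h f) (p h g) else 0
  map_add' X Y := by
    ext f g
    simp only [Matrix.of_apply, Matrix.add_apply, Finset.sum_add_distrib]
    split_ifs <;> ring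
  map_smul' c X := by
    ext f g
    simp only [Matrix.of_apply, Matrix.smul_apply, smul_eq_mul, RingHom.id_apply, ← Finset.mul_sum]
    split_ifs <;> ring

open Classical in
theorem Dep_apply {Ω : Type*} [Fintype Ω] (p : Ω → Ω → Ω) (X : Matrix Ω Ω ℂ) (f g : Ω) :
    Dep p X f g =
      if p f g = g then (Fintype.card Ω : ℂ)⁻¹ * ∑ h, X (p h f) (p h g) else 0 := rfl

theorem Dep_selfadj {Ω : Type*} [Fintype Ω] {p : Ω → Ω → Ω} (hp : IsBand p)
    (X Y : Matrix Ω Ω ℂ) : trace (Dep p X * Y) = trace (X * Dep p Y) := by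
  classical
  simp only [trace, diag_apply, mul_apply, Dep_apply]
  have e1 : ∀ f g : Ω, (if p f g = g then (Fintype.card Ω : ℂ)⁻¹ * ∑ h, X (p h f) (p h g) else 0) * Y g f
      = (Fintype.card Ω : ℂ)⁻¹ * ∑ h, if p f g = g then X (p h f) (p h g) * Y g f else 0 := by
    intro f g
    split_ifs
    · rw [mul_assoc, Finset.sum_mul]
    · simp
  have e2 : ∀ f g : Ω, X f g * (if p g f = f then (Fintype.card Ω : ℂ)⁻¹ * ∑ h, Y (p h g) (p h f) else 0)
      = (Fintype.card Ω : ℂ)⁻¹ * ∑ h, if p f g = g then X f g * Y (p h g) (p h f) else 0 := by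
    intro f g
    rw [← hp.symm_iff]
    split_ifs
    · rw [mul_left_comm, Finset.mul_sum]
    · simp
  simp only [e1, e2, ← Finset.mul_sum]
  congr 1
  have tr : ∀ F : Ω → Ω → Ω → ℂ, ∑ f, ∑ g, ∑ h, F f g h = ∑ x : Ω × Ω × Ω, F x.1 x.2.1 x.2.2 := by
    intro F; simp [Fintype.sum_prod_type]
  rw [tr (fun f g h => if p f g = g then X (p h f) (p h g) * Y g f else 0),
    tr (fun f g h => if p f g = g then X f g * Y (p h g) (p h f) else 0),
    ← Finset.sum_filter, ← Finset.sum_filter]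
  refine Finset.sum_nbij' (fun x => (p x.2.2 x.1, p x.2.2 x.2.1, p x.1 x.2.2))
    (fun x => (p x.2.2 x.1, p x.2.2 x.2.1, p x.1 x.2.2)) ?_ ?_ ?_ ?_ ?_
  all_goals
    rintro ⟨f, g, h⟩ hx
    simp only [Finset.mem_filter, Finset.mem_univ, true_and] at hx ⊢
  · rw [hp.left, hp.right]
  · rw [hp.left, hp.right]
  · simp only [hp.left, hp.right, hp.idem, hx]
  · simp only [hp.left, hp.right, hp.idem, hx]
  · simp only [hp.left, hp.right, hp.idem, hx]

theorem Dep_one {Ω : Type*} [Fintype Ω] [DecidableEq Ω] {p : Ω → Ω → Ω} (hp : IsBand p) :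
    Dep p 1 = (1 : Matrix Ω Ω ℂ) := by
  ext f g
  have : Nonempty Ω := ⟨f⟩
  have hc : (Fintype.card Ω : ℂ) ≠ 0 := by simp
  rw [Dep_apply, one_apply]
  by_cases h : p f g = g
  · rw [if_pos h]
    have : ∀ k, p k f = p k g ↔ f = g := by
      intro k
      constructor
      · intro hh
        have := congrArg (p f) hh
        rw [hp.right, hp.right, hp.idem, h] at this
        exact this
      · rintro rfl; rfl
    simp only [one_apply, this]
    split_ifs <;> simp [hc]
  · rw [if_neg h, if_neg]
    rintro rfl
    exact h (hp.idem _)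

theorem Dep_trace {Ω : Type*} [Fintype Ω] {p : Ω → Ω → Ω} (hp : IsBand p)
    (X : Matrix Ω Ω ℂ) : trace (Dep p X) = trace X := by
  classical
  have := Dep_selfadj hp X 1
  rwa [Dep_one hp, mul_one, mul_one] at this

theorem Dep_conj {Ω : Type*} [Fintype Ω] {p : Ω → Ω → Ω} (hp : IsBand p)
    (X : Matrix Ω Ω ℂ) : Dep p Xᴴ = (Dep p X)ᴴ := by
  ext f g
  rw [conjTranspose_apply, Dep_apply, Dep_apply, hp.symm_iff]
  split_ifs <;> simp

theorem Dep_snd {Ω : Type*} [Fintype Ω] (X : Matrix Ω Ω ℂ) : Dep (fun _ b => b) X = X := by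
  ext f g
  have : Nonempty Ω := ⟨f⟩
  have hc : (Fintype.card Ω : ℂ) ≠ 0 := by simp
  simp [Dep_apply, hc]

theorem Dep_fst {Ω : Type*} [Fintype Ω] [DecidableEq Ω] (X : Matrix Ω Ω ℂ) :
    Dep (fun a _ => a) X = ((Fintype.card Ω : ℂ)⁻¹ * trace X) • (1 : Matrix Ω Ω ℂ) := by
  ext f g
  simp [Dep_apply, one_apply, trace]

/-- product band -/
def prodBand {Ω Ω' : Type*} (p : Ω → Ω → Ω) (q : Ω' → Ω' → Ω') : Ω × Ω' → Ω × Ω' → Ω × Ω' :=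
  fun a b => (p a.1 b.1, q a.2 b.2)

theorem Dep_kron {Ω Ω' : Type*} [Fintype Ω] [Fintype Ω'] (p : Ω → Ω → Ω) (q : Ω' → Ω' → Ω')
    (M : Matrix Ω Ω ℂ) (N : Matrix Ω' Ω' ℂ) :
    Dep (prodBand p q) (M ⊗ₖ N) = Dep p M ⊗ₖ Dep q N := by
  ext ⟨f, f'⟩ ⟨g, g'⟩
  simp only [Dep_apply, kroneckerMap_apply, prodBand, Fintype.sum_prod_type, Prod.mk.injEq,
    Fintype.card_prod, Nat.cast_mul, mul_inv]
  by_cases h1 : p f g = g <;> by_cases h2 : q f' g' = g' <;> simp [h1, h2]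
  rw [mul_mul_mul_comm, Finset.sum_mul_sum]

theorem Dep_prod_snd {Ω Ω' : Type*} [Fintype Ω] [Fintype Ω'] (p : Ω → Ω → Ω)
    (X : Matrix (Ω × Ω') (Ω × Ω') ℂ) (a a' : Ω) (b b' : Ω') :
    Dep (prodBand p (fun _ b => b)) X (a, b) (a', b') =
      Dep p (Matrix.of fun x x' => X (x, b) (x', b')) a a' := by
  have : Nonempty Ω' := ⟨b⟩
  have hc : (Fintype.card Ω' : ℂ) ≠ 0 := by simp
  by_cases hh : p a a' = a'
  · rw [Dep_apply, Dep_apply, if_pos hh, if_pos (by rw [prodBand, hh])]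
    simp only [prodBand, Fintype.sum_prod_type,
      Fintype.card_prod, Nat.cast_mul, mul_inv, of_apply, Finset.sum_const, Finset.card_univ,
      nsmul_eq_mul, ← Finset.mul_sum]
    field_simp
  · rw [Dep_apply, Dep_apply, if_neg hh, if_neg (by simpa [prodBand] using hh)]

theorem Dep_snd_prod {Ω Ω' : Type*} [Fintype Ω] [Fintype Ω'] (p : Ω' → Ω' → Ω')
    (X : Matrix (Ω × Ω') (Ω × Ω') ℂ) (a a' : Ω) (b b' : Ω') :
    Dep (prodBand (fun _ b => b) p) X (a, b) (a', b') =
      Dep p (Matrix.of fun x x' => X (a, x) (a', x')) b b' := by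
  have : Nonempty Ω := ⟨a⟩
  have hc : (Fintype.card Ω : ℂ) ≠ 0 := by simp
  by_cases hh : p b b' = b'
  · rw [Dep_apply, Dep_apply, if_pos hh, if_pos (by rw [prodBand, hh])]
    simp only [prodBand, Fintype.sum_prod_type,
      Fintype.card_prod, Nat.cast_mul, mul_inv, of_apply, Finset.sum_const, Finset.card_univ,
      nsmul_eq_mul, ← Finset.mul_sum]
    field_simp
  · rw [Dep_apply, Dep_apply, if_neg hh, if_neg (by simpa [prodBand] using hh)]

theorem Dep_reindex {Ω Ω' : Type*} [Fintype Ω] [Fintype Ω'] (e : Ω ≃ Ω') (p : Ω → Ω → Ω)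
    (q : Ω' → Ω' → Ω') (h : ∀ a b, e (p a b) = q (e a) (e b)) (X : Matrix Ω Ω ℂ) :
    Dep q (reindex e e X) = reindex e e (Dep p X) := by
  have h' : ∀ a b, e.symm (q a b) = p (e.symm a) (e.symm b) := by
    intro a b; rw [Equiv.symm_apply_eq, h]; simp
  ext f g
  have this : q f g = g ↔ p (e.symm f) (e.symm g) = e.symm g := by
    rw [← h', e.symm.injective.eq_iff]
  have hs : ∑ h, X (e.symm (q h f)) (e.symm (q h g)) = ∑ h, X (p h (e.symm f)) (p h (e.symm g)) := by
    rw [← Equiv.sum_comp e.symm (fun h => X (p h (e.symm f)) (p h (e.symm g)))]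
    exact Finset.sum_congr rfl fun h _ => by rw [h', h']
  rw [reindex_apply, reindex_apply, submatrix_apply, Dep_apply, Dep_apply, Fintype.card_congr e]
  simp only [submatrix_apply, hs]
  by_cases hh : q f g = g
  · rw [if_pos hh, if_pos (this.1 hh)]
  · rw [if_neg hh, if_neg (fun h => hh (this.2 h))]

open Classical in
/-- coordinatewise mixing -/
def pw {ι : Type*} {H : ι → Type*} (J : Set ι) (h f : ∀ i, H i) : ∀ i, H i :=
  fun i => if i ∈ J then h i else f i

theorem pw_of_mem {ι : Type*} {H : ι → Type*} {J : Set ι} (h f : ∀ i, H i) {i : ι} (hi : i ∈ J) :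
    pw J h f i = h i := if_pos hi

theorem pw_of_not_mem {ι : Type*} {H : ι → Type*} {J : Set ι} (h f : ∀ i, H i) {i : ι} (hi : i ∉ J) :
    pw J h f i = f i := if_neg hi

theorem isBand_pw {ι : Type*} {H : ι → Type*} (J : Set ι) : IsBand (pw (H := H) J) := by
  constructor
  · intro a; funext i; simp [pw]
  · intro a b c; funext i; unfold pw; split_ifs <;> rfl
  · intro a b c; funext i; unfold pw; split_ifs <;> rfl

theorem pw_empty {ι : Type*} {H : ι → Type*} : pw (H := H) (∅ : Set ι) = fun _ b => b := by
  funext a b i; simp [pw]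

theorem pw_univ {ι : Type*} {H : ι → Type*} : pw (H := H) (Set.univ : Set ι) = fun a _ => a := by
  funext a b i; simp [pw]

theorem sum_pw {ι : Type*} [Fintype ι] [DecidableEq ι] {H : ι → Type*} [∀ i, Fintype (H i)]
    (K : Set ι) (F : (∀ i, H i) → ℂ) :
    ∑ h, ∑ h', F (pw K h' h) = Fintype.card (∀ i, H i) * ∑ h, F h := by
  rw [← Fintype.sum_prod_type']
  have : ∑ x : (∀ i, H i) × (∀ i, H i), F (pw K x.2 x.1) = ∑ x : (∀ i, H i) × (∀ i, H i), F x.1 := by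
    refine Finset.sum_nbij' (fun x => (pw K x.2 x.1, pw K x.1 x.2))
      (fun x => (pw K x.2 x.1, pw K x.1 x.2)) ?_ ?_ ?_ ?_ ?_
    · simp
    · simp
    · rintro ⟨a, b⟩ -
      ext i <;> simp only [pw] <;> split_ifs <;> rfl
    · rintro ⟨a, b⟩ -
      ext i <;> simp only [pw] <;> split_ifs <;> rfl
    · simp
  rw [this, Fintype.sum_prod_type]
  simp [Finset.mul_sum]

theorem Dep_pw_comp {ι : Type*} [Fintype ι] [DecidableEq ι] {H : ι → Type*} [∀ i, Fintype (H i)]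
    (J K : Set ι) (X : Matrix (∀ i, H i) (∀ i, H i) ℂ) :
    Dep (pw J) (Dep (pw K) X) = Dep (pw (J ∪ K)) X := by
  classical
  ext f g
  have : Nonempty (∀ i, H i) := ⟨f⟩
  have hc : (Fintype.card (∀ i, H i) : ℂ) ≠ 0 := by exact_mod_cast Fintype.card_ne_zero
  have hiff : ∀ (L : Set ι) (f g : ∀ i, H i), pw L f g = g ↔ ∀ i ∈ L, f i = g i := by
    intro L f g
    constructor
    · intro h i hi; rw [← h, pw_of_mem _ _ hi]
    · intro h; funext i
      by_cases hi : i ∈ L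
      · rw [pw_of_mem _ _ hi, h i hi]
      · rw [pw_of_not_mem _ _ hi]
  have hcomb : ∀ h h' f : ∀ i, H i, pw K h' (pw J h f) = pw (J ∪ K) (pw K h' h) f := by
    intro h h' f; funext i
    by_cases h1 : i ∈ J <;> by_cases h2 : i ∈ K <;> simp [pw, h1, h2]
  by_cases hJ : ∀ i ∈ J, f i = g i
  · have hK : ∀ h : ∀ i, H i, pw K (pw J h f) (pw J h g) = pw J h g ↔ pw (J ∪ K) f g = g := by
      intro h
      rw [hiff, hiff]
      constructor
      · intro hh i hi
        by_cases h1 : i ∈ J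
        · exact hJ i h1
        · have := hh i (hi.resolve_left h1)
          rwa [pw_of_not_mem _ _ h1, pw_of_not_mem _ _ h1] at this
      · intro hh i hi
        by_cases h1 : i ∈ J
        · rw [pw_of_mem _ _ h1, pw_of_mem _ _ h1]
        · rw [pw_of_not_mem _ _ h1, pw_of_not_mem _ _ h1]; exact hh i (Or.inr hi)
    rw [Dep_apply, if_pos ((hiff J f g).2 hJ), Dep_apply]
    simp only [Dep_apply, hK]
    split_ifs
    · rw [← Finset.mul_sum]
      simp only [hcomb]
      rw [sum_pw K (fun h => X (pw (J ∪ K) h f) (pw (J ∪ K) h g))]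
      field_simp
    · simp
  · rw [Dep_apply, if_neg (by rwa [hiff]), Dep_apply, if_neg]
    rw [hiff]
    intro h
    exact hJ fun i hi => h i (Or.inl hi)

/-- tail depolarization -/
def ED (H : ℕ → Type) [∀ j, Fintype (H j)] (q c : ℕ) :
    Matrix (∀ j : Fin q, H j) (∀ j : Fin q, H j) ℂ →ₗ[ℂ]
      Matrix (∀ j : Fin q, H j) (∀ j : Fin q, H j) ℂ :=
  Dep (pw (H := fun j : Fin q => H j) {j : Fin q | c ≤ (j : ℕ)})

theorem ED_comp (H : ℕ → Type) [∀ j, Fintype (H j)] (q a b : ℕ)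
    (X : Matrix (∀ j : Fin q, H j) (∀ j : Fin q, H j) ℂ) :
    ED H q a (ED H q b X) = ED H q (min a b) X := by
  unfold ED
  rw [Dep_pw_comp]
  congr 3
  ext j
  simp

theorem ED_top (H : ℕ → Type) [∀ j, Fintype (H j)] (q a : ℕ) (h : q ≤ a)
    (X : Matrix (∀ j : Fin q, H j) (∀ j : Fin q, H j) ℂ) :
    ED H q a X = X := by
  unfold ED
  have : {j : Fin q | a ≤ (j : ℕ)} = ∅ := by
    ext j; simp; omega
  rw [this, pw_empty, Dep_snd]

theorem ED_zero (H : ℕ → Type) [∀ j, Fintype (H j)] [∀ j, DecidableEq (H j)] (q : ℕ)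
    (X : Matrix (∀ j : Fin q, H j) (∀ j : Fin q, H j) ℂ) :
    ED H q 0 X = ((Fintype.card (∀ j : Fin q, H j) : ℂ)⁻¹ * trace X) • 1 := by
  unfold ED
  have : {j : Fin q | 0 ≤ (j : ℕ)} = Set.univ := by
    ext j; simp
  rw [this, pw_univ, Dep_fst]

theorem ED_trace (H : ℕ → Type) [∀ j, Fintype (H j)] (q a : ℕ)
    (X : Matrix (∀ j : Fin q, H j) (∀ j : Fin q, H j) ℂ) :
    trace (ED H q a X) = trace X := Dep_trace (isBand_pw _) X

theorem ED_one (H : ℕ → Type) [∀ j, Fintype (H j)] [∀ j, DecidableEq (H j)] (q a : ℕ) :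
    (ED H q a 1) = 1 := Dep_one (isBand_pw _)

theorem ED_conj (H : ℕ → Type) [∀ j, Fintype (H j)] (q a : ℕ)
    (X : Matrix (∀ j : Fin q, H j) (∀ j : Fin q, H j) ℂ) :
    (ED H q a Xᴴ) = (ED H q a X)ᴴ := Dep_conj (isBand_pw _) X

theorem ED_selfadj (H : ℕ → Type) [∀ j, Fintype (H j)] (q a : ℕ)
    (X Y : Matrix (∀ j : Fin q, H j) (∀ j : Fin q, H j) ℂ) :
    trace (ED H q a X * Y) = trace (X * ED H q a Y) := Dep_selfadj (isBand_pw _) X Y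

/-- homogeneous comb conditions -/
def VV (n : ℕ) (H : ℕ → Type) [∀ j, Fintype (H j)] :
    Submodule ℂ (Matrix (∀ j : Fin (2 * n), H j) (∀ j : Fin (2 * n), H j) ℂ) where
  carrier := {X | ∀ k < n, ED H (2 * n) (2 * k + 1) X = ED H (2 * n) (2 * k) X}
  add_mem' := by
    intro a b ha hb k hk
    rw [map_add, map_add, ha k hk, hb k hk]
  zero_mem' := by
    intro k hk
    rw [map_zero, map_zero]
  smul_mem' := by
    intro c a ha k hk
    rw [map_smul, map_smul, ha k hk]

theorem mem_VV {n : ℕ} {H : ℕ → Type} [∀ j, Fintype (H j)]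
    {X : Matrix (∀ j : Fin (2 * n), H j) (∀ j : Fin (2 * n), H j) ℂ} :
    X ∈ VV n H ↔ ∀ k < n, ED H (2 * n) (2 * k + 1) X = ED H (2 * n) (2 * k) X := Iff.rfl

/-- normalization constant -/
def nrm (n : ℕ) (H : ℕ → Type) [∀ j, Fintype (H j)] : ℂ :=
  ∏ k : Fin n, (Fintype.card (H (2 * (k : ℕ))) : ℂ)

def Good (n : ℕ) (H : ℕ → Type) [∀ j, Fintype (H j)]
    (R : Matrix (∀ j : Fin (2 * n), H j) (∀ j : Fin (2 * n), H j) ℂ) : Prop :=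
  R.PosSemidef ∧ trace R = nrm n H ∧ R ∈ VV n H

theorem nrm_pos (n : ℕ) (H : ℕ → Type) [∀ j, Fintype (H j)] (hH : ∀ j < 2 * n, Nonempty (H j)) :
    0 < nrm n H := by
  unfold nrm
  refine Finset.prod_pos fun k _ => ?_
  have := hH (2 * k) (by have := k.isLt; omega)
  exact_mod_cast Fintype.card_pos

theorem one_mem_VV (n : ℕ) (H : ℕ → Type) [∀ j, Fintype (H j)] [∀ j, DecidableEq (H j)] :
    1 ∈ VV n H := by
  intro k hk
  rw [ED_one, ED_one]

open scoped Matrix.Norms.L2Operator MatrixOrder in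
theorem exists_shift {Ω : Type*} [Fintype Ω] [DecidableEq Ω] (T : Matrix Ω Ω ℂ)
    (hT : T.IsHermitian) : ∃ t : ℝ, 0 ≤ t ∧ (T + (t : ℂ) • (1 : Matrix Ω Ω ℂ)).PosSemidef := by
  refine ⟨‖T‖, norm_nonneg _, ?_⟩
  have hs : IsSelfAdjoint T := hT
  have := hs.neg_algebraMap_norm_le_self
  rw [Matrix.le_iff, sub_neg_eq_add] at this
  have e : ((‖T‖ : ℝ) : ℂ) • (1 : Matrix Ω Ω ℂ) = algebraMap ℝ (Matrix Ω Ω ℂ) ‖T‖ := by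
    rw [Algebra.algebraMap_eq_smul_one]
    ext i j
    simp
  rw [e]
  exact this

theorem psd_mem_span {n : ℕ} {H : ℕ → Type} [∀ j, Fintype (H j)]
    (hH : ∀ j < 2 * n, Nonempty (H j))
    {X : Matrix (∀ j : Fin (2 * n), H j) (∀ j : Fin (2 * n), H j) ℂ}
    (hX : X.PosSemidef) (ht : 0 < trace X) (hV : X ∈ VV n H) :
    X ∈ Submodule.span ℂ {S | Good n H S} := by
  have hn := nrm_pos n H hH
  have h1 : X = (trace X / nrm n H) • ((nrm n H / trace X) • X) := by
    rw [smul_smul, div_mul_div_cancel₀ hn.ne', div_self ht.ne', one_smul]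
  rw [h1]
  refine Submodule.smul_mem _ _ (Submodule.subset_span ⟨?_, ?_, Submodule.smul_mem _ _ hV⟩)
  · exact hX.smul (div_pos hn ht).le
  · rw [trace_smul, smul_eq_mul, div_mul_cancel₀ _ ht.ne']

theorem pi_nonempty {q : ℕ} {H : ℕ → Type} (hH : ∀ j < q, Nonempty (H j)) :
    Nonempty (∀ j : Fin q, H j) :=
  ⟨fun j => (hH j j.isLt).some⟩

theorem herm_mem_span {n : ℕ} {H : ℕ → Type} [∀ j, Fintype (H j)] [∀ j, DecidableEq (H j)]
    (hH : ∀ j < 2 * n, Nonempty (H j))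
    {X : Matrix (∀ j : Fin (2 * n), H j) (∀ j : Fin (2 * n), H j) ℂ}
    (hX : X.IsHermitian) (hV : X ∈ VV n H) :
    X ∈ Submodule.span ℂ {S | Good n H S} := by
  have hne := pi_nonempty hH
  obtain ⟨t, ht0, ht⟩ := exists_shift X hX
  have hN : (0 : ℂ) < trace (1 : Matrix (∀ j : Fin (2 * n), H j) (∀ j : Fin (2 * n), H j) ℂ) := by
    rw [trace_one]; exact_mod_cast Fintype.card_pos
  have h1 : (1 : Matrix (∀ j : Fin (2 * n), H j) (∀ j : Fin (2 * n), H j) ℂ) ∈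
      Submodule.span ℂ {S | Good n H S} := psd_mem_span hH PosSemidef.one hN (one_mem_VV n H)
  have h2 : (X + (t : ℂ) • 1) + 1 ∈ Submodule.span ℂ {S | Good n H S} := by
    refine psd_mem_span hH (ht.add PosSemidef.one) ?_ ?_
    · rw [trace_add]
      exact add_pos_of_nonneg_of_pos ht.trace_nonneg hN
    · exact Submodule.add_mem _ (Submodule.add_mem _ hV (Submodule.smul_mem _ _ (one_mem_VV n H)))
        (one_mem_VV n H)
  have := Submodule.sub_mem _ (Submodule.sub_mem _ h2 h1) (Submodule.smul_mem _ (t : ℂ) h1)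
  convert this using 1
  abel

theorem VV_le_span {n : ℕ} {H : ℕ → Type} [∀ j, Fintype (H j)] [∀ j, DecidableEq (H j)]
    (hH : ∀ j < 2 * n, Nonempty (H j)) :
    VV n H ≤ Submodule.span ℂ {S | Good n H S} := by
  intro X hX
  have hc : Xᴴ ∈ VV n H := by
    intro k hk
    rw [ED_conj, ED_conj, hX k hk]
  have h1 : X + Xᴴ ∈ Submodule.span ℂ {S | Good n H S} := by
    refine herm_mem_span hH ?_ (Submodule.add_mem _ hX hc)
    exact isHermitian_add_transpose_self X
  have h2 : Complex.I • (X - Xᴴ) ∈ Submodule.span ℂ {S | Good n H S} := by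
    refine herm_mem_span hH ?_ (Submodule.smul_mem _ _ (Submodule.sub_mem _ hX hc))
    rw [IsHermitian, conjTranspose_smul, conjTranspose_sub, conjTranspose_conjTranspose]
    simp [← smul_neg]
  have := Submodule.add_mem _ (Submodule.smul_mem _ (1/2 : ℂ) h1)
    (Submodule.smul_mem _ (-Complex.I/2 : ℂ) h2)
  convert this using 1
  rw [smul_smul]
  have : -Complex.I / 2 * Complex.I = 1/2 := by
    rw [div_mul_eq_mul_div, neg_mul, Complex.I_mul_I]; norm_num
  rw [this, ← smul_add]
  ext i j
  simp
  ring

theorem trace_reindex_self {Ω Ω' : Type*} [Fintype Ω] [Fintype Ω'] (e : Ω ≃ Ω') (X : Matrix Ω Ω ℂ) :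
    trace (reindex e e X) = trace X := by
  simp only [trace, diag_apply, reindex_apply, submatrix_apply]
  exact Equiv.sum_comp e.symm (fun i => X i i)

theorem reindex_mul_self {Ω Ω' : Type*} [Fintype Ω] [Fintype Ω'] (e : Ω ≃ Ω') (X Y : Matrix Ω Ω ℂ) :
    reindex e e X * reindex e e Y = reindex e e (X * Y) := by
  simp only [reindex_apply]
  exact submatrix_mul_equiv _ _ _ _ _

/-- test elements -/
def tst (H : ℕ → Type) (q : ℕ) (Z : Matrix (H 0) (H 0) ℂ)
    (T : Matrix (∀ j : Fin q, H (j + 1)) (∀ j : Fin q, H (j + 1)) ℂ)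
    (Q : Matrix (H (q + 1)) (H (q + 1)) ℂ) :
    Matrix (∀ j : Fin (q + 2), H j) (∀ j : Fin (q + 2), H j) ℂ :=
  reindex (splitEnds H q).symm (splitEnds H q).symm (Z ⊗ₖ (T ⊗ₖ Q))

theorem tst_add (H : ℕ → Type) (q : ℕ) (Z : Matrix (H 0) (H 0) ℂ)
    (T T' : Matrix (∀ j : Fin q, H (j + 1)) (∀ j : Fin q, H (j + 1)) ℂ)
    (Q : Matrix (H (q + 1)) (H (q + 1)) ℂ) : tst H q Z (T + T') Q = tst H q Z T Q + tst H q Z T' Q := by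
  ext f g
  simp [tst, kroneckerMap_apply]; ring

theorem tst_smul (H : ℕ → Type) (q : ℕ) (Z : Matrix (H 0) (H 0) ℂ) (c : ℂ)
    (T : Matrix (∀ j : Fin q, H (j + 1)) (∀ j : Fin q, H (j + 1)) ℂ)
    (Q : Matrix (H (q + 1)) (H (q + 1)) ℂ) : tst H q Z (c • T) Q = c • tst H q Z T Q := by
  ext f g
  simp [tst, kroneckerMap_apply]; ring

theorem tst_smul_right (H : ℕ → Type) (q : ℕ) (Z : Matrix (H 0) (H 0) ℂ) (c : ℂ)
    (T : Matrix (∀ j : Fin q, H (j + 1)) (∀ j : Fin q, H (j + 1)) ℂ)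
    (Q : Matrix (H (q + 1)) (H (q + 1)) ℂ) : tst H q Z T (c • Q) = c • tst H q Z T Q := by
  ext f g
  simp [tst, kroneckerMap_apply]; ring

theorem tst_sub (H : ℕ → Type) (q : ℕ) (Z : Matrix (H 0) (H 0) ℂ)
    (T T' : Matrix (∀ j : Fin q, H (j + 1)) (∀ j : Fin q, H (j + 1)) ℂ)
    (Q : Matrix (H (q + 1)) (H (q + 1)) ℂ) : tst H q Z (T - T') Q = tst H q Z T Q - tst H q Z T' Q := by
  ext f g
  simp [tst, kroneckerMap_apply]; ring

theorem tst_trace (H : ℕ → Type) [∀ j, Fintype (H j)] (q : ℕ) (Z : Matrix (H 0) (H 0) ℂ)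
    (T : Matrix (∀ j : Fin q, H (j + 1)) (∀ j : Fin q, H (j + 1)) ℂ)
    (Q : Matrix (H (q + 1)) (H (q + 1)) ℂ) :
    trace (tst H q Z T Q) = trace Z * (trace T * trace Q) := by
  rw [tst, trace_reindex_self, trace_kronecker, trace_kronecker]

theorem tst_one (H : ℕ → Type) [∀ j, DecidableEq (H j)] (q : ℕ) :
    tst H q 1 1 1 = 1 := by
  rw [tst, one_kronecker_one, one_kronecker_one]
  simp

theorem tst_pair (H : ℕ → Type) [∀ j, Fintype (H j)] (q : ℕ) (Z : Matrix (H 0) (H 0) ℂ)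
    (T : Matrix (∀ j : Fin q, H (j + 1)) (∀ j : Fin q, H (j + 1)) ℂ)
    (Q : Matrix (H (q + 1)) (H (q + 1)) ℂ)
    (R : Matrix (∀ j : Fin (q + 2), H j) (∀ j : Fin (q + 2), H j) ℂ) :
    trace (tst H q Z T Q * R) =
      trace ((Z ⊗ₖ (T ⊗ₖ Q)) * reindex (splitEnds H q) (splitEnds H q) R) := by
  rw [← trace_reindex_self (splitEnds H q), ← reindex_mul_self, tst]
  congr 2
  ext; simp

theorem ED_tst (H : ℕ → Type) [∀ j, Fintype (H j)] (q c : ℕ) (hc : c ≤ q)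
    (Z : Matrix (H 0) (H 0) ℂ)
    (T : Matrix (∀ j : Fin q, H (j + 1)) (∀ j : Fin q, H (j + 1)) ℂ)
    (Q : Matrix (H (q + 1)) (H (q + 1)) ℂ) :
    ED H (q + 2) (c + 1) (tst H q Z T Q) =
      tst H q Z (ED (fun j => H (j + 1)) q c T) (Dep (fun a _ => a) Q) := by
  have key : Dep (prodBand (fun _ b => b) (prodBand (pw (H := fun j : Fin q => H (j + 1))
      {j : Fin q | c ≤ (j : ℕ)}) (fun a _ => a))) (Z ⊗ₖ (T ⊗ₖ Q)) =
      Z ⊗ₖ (Dep (pw (H := fun j : Fin q => H (j + 1)) {j : Fin q | c ≤ (j : ℕ)}) T ⊗ₖ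
        Dep (fun a _ => a) Q) := by
    rw [Dep_kron, Dep_kron, Dep_snd]
  rw [tst, tst, ED, ED, ← key]
  apply Dep_reindex
  intro a b
  rw [Equiv.symm_apply_eq]
  obtain ⟨a, rfl⟩ := (splitEnds H q).surjective a
  obtain ⟨b, rfl⟩ := (splitEnds H q).surjective b
  rw [Equiv.symm_apply_apply, Equiv.symm_apply_apply]
  refine Prod.ext ?_ (Prod.ext ?_ ?_)
  · exact (pw_of_not_mem a b (i := ⟨0, by omega⟩) (by simp)).symm
  · funext j
    by_cases hj : c ≤ (j : ℕ)
    · refine (pw_of_mem _ _ (by simpa using hj)).trans ?_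
      exact (pw_of_mem a b (i := ⟨j + 1, by omega⟩) (by simpa using hj)).symm
    · refine (pw_of_not_mem _ _ (by simpa using hj)).trans ?_
      exact (pw_of_not_mem a b (i := ⟨j + 1, by omega⟩) (by simpa using hj)).symm
  · exact (pw_of_mem a b (i := ⟨q + 1, by omega⟩) (by simpa using hc)).symm

theorem eq_zero_of_tst (H : ℕ → Type) [∀ j, Fintype (H j)] (q : ℕ)
    (R : Matrix (∀ j : Fin (q + 2), H j) (∀ j : Fin (q + 2), H j) ℂ)
    (h : ∀ Z T Q, trace (tst H q Z T Q * R) = 0) : R = 0 := by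
  classical
  have h2 : reindex (splitEnds H q) (splitEnds H q) R = 0 := by
    ext ⟨a, b, c⟩ ⟨a', b', c'⟩
    have := h (single a' a 1) (single b' b 1) (single c' c 1)
    rw [tst_pair, single_kronecker_single, single_kronecker_single, trace_single_mul] at this
    simpa using this
  exact (reindex (splitEnds H q) (splitEnds H q)).injective (by rw [h2]; ext; simp)

theorem prod_split (f : ℕ → ℂ) (n : ℕ) : ∏ j ∈ Finset.range (2 * n), f j =
    (∏ k ∈ Finset.range n, f (2 * k)) * ∏ k ∈ Finset.range n, f (2 * k + 1) := by
  induction n with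
  | zero => simp
  | succ n ih =>
    rw [show 2 * (n + 1) = 2 * n + 1 + 1 by ring, Finset.prod_range_succ, Finset.prod_range_succ, ih,
      Finset.prod_range_succ, Finset.prod_range_succ]
    ring

theorem nrm_eq (n : ℕ) (H : ℕ → Type) [∀ j, Fintype (H j)] :
    nrm n H = ∏ k ∈ Finset.range n, (Fintype.card (H (2 * k)) : ℂ) := by
  rw [nrm, Finset.prod_range]

theorem card_eq (q : ℕ) (H : ℕ → Type) [∀ j, Fintype (H j)] :
    (Fintype.card (∀ j : Fin q, H j) : ℂ) = ∏ k ∈ Finset.range q, (Fintype.card (H k) : ℂ) := by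
  rw [Fintype.card_pi, Finset.prod_range]
  push_cast
  rfl

theorem dual_mpr (n : ℕ) (H : ℕ → Type) [∀ j, Fintype (H j)] [∀ j, DecidableEq (H j)]
    (hH : ∀ j < 2 * n + 2, Nonempty (H j))
    (R : Matrix (∀ j : Fin (2 * n + 2), H j) (∀ j : Fin (2 * n + 2), H j) ℂ)
    (ht : trace R = nrm (n + 1) H)
    (hR : ∀ k < n + 1, ED H (2 * n + 2) (2 * k + 1) R = ED H (2 * n + 2) (2 * k) R)
    (S) (hS : Good n (fun j => H (j + 1)) S) (Z) :
    trace (tst H (2 * n) Z S 1 * R) = trace Z := by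
  set Y := tst H (2 * n) Z S 1 with hY
  have hl : Nonempty (H (2 * n + 1)) := hH _ (by omega)
  have hl' : (Fintype.card (H (2 * n + 1)) : ℂ) ≠ 0 := by exact_mod_cast Fintype.card_ne_zero
  have hD1 : Dep (fun a _ => a) (1 : Matrix (H (2 * n + 1)) (H (2 * n + 1)) ℂ) = 1 := by
    rw [Dep_fst, trace_one, inv_mul_cancel₀ hl', one_smul]
  have step : ∀ c ≤ 2 * n + 2, trace (ED H (2 * n + 2) c Y * R) = trace (ED H (2 * n + 2) 0 Y * R) := by
    intro c
    induction c with
    | zero => intro _; rfl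
    | succ c ih =>
      intro hc
      rw [← ih (by omega)]
      obtain ⟨k, rfl | rfl⟩ := Nat.even_or_odd' c
      · rw [ED_selfadj, ED_selfadj, hR k (by omega)]
      · congr 2
        by_cases hk : k = n
        · subst hk
          rw [ED_top _ _ _ (by omega), hY, ED_tst _ _ _ (by omega), ED_top _ _ _ (by omega), hD1]
        · rw [hY, ED_tst _ _ _ (by omega), ED_tst _ _ _ (by omega), hS.2.2 k (by omega)]
  have h0 := step (2 * n + 2) le_rfl
  rw [ED_top _ _ _ le_rfl, ED_zero, smul_mul_assoc, one_mul, trace_smul, ht, hY, tst_trace, hS.2.1,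
    trace_one, smul_eq_mul] at h0
  rw [h0]
  have hcard : (Fintype.card (∀ j : Fin (2 * n + 2), H j) : ℂ) =
      nrm (n + 1) H * (nrm n (fun j => H (j + 1)) * Fintype.card (H (2 * n + 1))) := by
    rw [card_eq, show 2 * n + 2 = 2 * (n + 1) by ring,
      prod_split (fun j => (Fintype.card (H j) : ℂ)), nrm_eq, nrm_eq]
    rw [Finset.prod_range_succ (fun k => (Fintype.card (H (2 * k + 1)) : ℂ))]
  have hne : (Fintype.card (∀ j : Fin (2 * n + 2), H j) : ℂ) ≠ 0 := by
    have := pi_nonempty hH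
    exact_mod_cast Fintype.card_ne_zero
  rw [hcard] at hne ⊢
  rw [inv_mul_eq_div, div_mul_eq_mul_div, div_eq_iff hne]
  ring

theorem dual_mp (n : ℕ) (H : ℕ → Type) [∀ j, Fintype (H j)] [∀ j, DecidableEq (H j)]
    (hH : ∀ j < 2 * n + 2, Nonempty (H j))
    (R : Matrix (∀ j : Fin (2 * n + 2), H j) (∀ j : Fin (2 * n + 2), H j) ℂ)
    (h : ∀ S, Good n (fun j => H (j + 1)) S → ∀ Z, trace (tst H (2 * n) Z S 1 * R) = trace Z) :
    trace R = nrm (n + 1) H ∧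
    ∀ k < n + 1, ED H (2 * n + 2) (2 * k + 1) R = ED H (2 * n + 2) (2 * k) R := by
  have hc := (nrm_pos n (fun j => H (j + 1)) (fun j hj => hH _ (by omega))).ne'
  have h' : ∀ T ∈ VV n (fun j => H (j + 1)), ∀ Z,
      trace (tst H (2 * n) Z T 1 * R) * nrm n (fun j => H (j + 1)) = trace Z * trace T := by
    intro T hT Z
    have hT' := VV_le_span (fun j hj => hH _ (by omega)) hT
    clear hT
    induction hT' using Submodule.span_induction with
    | mem S hS => rw [h S hS Z, hS.2.1]
    | zero =>
      have : tst H (2 * n) Z 0 1 = 0 := by ext; simp [tst]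
      rw [this]; simp
    | add x y _ _ hx hy => rw [tst_add, add_mul, trace_add, trace_add, add_mul, hx, hy, mul_add]
    | smul c x _ hx =>
      rw [tst_smul, smul_mul_assoc, trace_smul, trace_smul, smul_eq_mul, smul_eq_mul, mul_assoc, hx]
      ring
  have h0 : ∀ T ∈ VV n (fun j => H (j + 1)), ∀ Z, trace Z * trace T = 0 →
      trace (tst H (2 * n) Z T 1 * R) = 0 := by
    intro T hT Z hh
    have := h' T hT Z
    rw [hh] at this
    exact (mul_eq_zero.1 this).resolve_right hc
  refine ⟨?_, ?_⟩
  · have := h' 1 (one_mem_VV n (fun j => H (j + 1))) 1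
    rw [tst_one, one_mul, trace_one, trace_one, card_eq (2 * n) (fun j => H (j + 1)),
      prod_split (fun j => (Fintype.card (H (j + 1)) : ℂ))] at this
    apply mul_right_cancel₀ hc
    rw [this, nrm_eq, nrm_eq, Finset.prod_range_succ']
    simp only [mul_add, mul_zero, mul_one, add_assoc]
    norm_num only
    rw [mul_comm (∏ _ ∈ _, _) (∏ _ ∈ _, _), ← mul_assoc, mul_right_comm, mul_comm (_ * _), mul_assoc]
  · intro k hk
    rw [← sub_eq_zero]
    apply eq_zero_of_tst
    intro Z T Q
    rw [mul_sub, trace_sub, ← ED_selfadj, ← ED_selfadj, ← trace_sub, ← sub_mul]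
    rcases k with _ | k
    · rw [mul_zero, ED_tst _ _ _ (by omega)]
      have e : ED H (2 * n + 2) 0 (tst H (2 * n) Z T Q) =
          ED H (2 * n + 2) 0 (ED H (2 * n + 2) (0 + 1) (tst H (2 * n) Z T Q)) := by
        rw [ED_comp]; rfl
      rw [e, ED_tst _ _ _ (by omega), ED_zero, ED_zero, Dep_fst]
      rw [tst_smul, tst_smul_right, sub_mul]
      set a := (Fintype.card (∀ j : Fin (2 * n), H (j + 1)) : ℂ)⁻¹ * trace T
      set b := (Fintype.card (H (2 * n + 1)) : ℂ)⁻¹ * trace Q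
      have t1 := h' 1 (one_mem_VV n (fun j => H (j + 1))) 1
      have t2 := h' 1 (one_mem_VV n (fun j => H (j + 1))) Z
      rw [tst_one, one_mul] at t1
      have hN : (Fintype.card (∀ j : Fin (2 * n + 2), H j) : ℂ) ≠ 0 := by
        have := pi_nonempty hH
        exact_mod_cast Fintype.card_ne_zero
      have hN' := tst_trace H (2 * n) 1 1 1
      rw [tst_one] at hN'
      simp only [smul_mul_assoc, one_mul, trace_sub, trace_smul, tst_trace, smul_eq_mul]
      apply mul_right_cancel₀ hc
      rw [zero_mul]
      rw [trace_one] at hN'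
      simp only [trace_one] at hN' t1 t2 ⊢
      have : ∀ N x r c d0 m l z A : ℂ, N ≠ 0 → N = d0 * (m * l) → r * c = d0 * m → x * c = z * m →
         (A * x - N⁻¹ * (A * (z * (m * l))) * r) * c = 0 := by
        intro N x r c d0 m l z A hN h1 h2 h3
        have : (A * x - N⁻¹ * (A * (z * (m * l))) * r) * c =
          A * (x * c) - N⁻¹ * (A * (z * (m * l))) * (r * c) := by ring
        rw [this, h2, h3]
        field_simp
        rw [h1]; ring
      have := this _ _ _ _ _ _ _ _ (a * b) hN hN' t1 t2
      rw [← this]; ring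
    · rw [show 2 * (k + 1) + 1 = (2 * k + 2) + 1 by ring, show 2 * (k + 1) = (2 * k + 1) + 1 by ring,
        ED_tst _ _ _ (by omega), ED_tst _ _ _ (by omega), ← tst_sub, Dep_fst, tst_smul_right,
        smul_mul_assoc, trace_smul, h0, smul_zero]
      · intro l hl
        simp only [map_sub, ED_comp]
        rcases lt_or_ge l (k + 1) with h1 | h1
        · rw [min_eq_left (by omega), min_eq_left (by omega), min_eq_left (by omega),
            min_eq_left (by omega), sub_self, sub_self]
        · rw [min_eq_right (by omega), min_eq_right (by omega), min_eq_right (by omega),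
            min_eq_right (by omega)]
      · rw [trace_sub, ED_trace, ED_trace, sub_self, mul_zero]

theorem trace_ptr {α β γ : Type*} [Fintype α] [DecidableEq α] [Fintype β] [DecidableEq β]
    [Fintype γ] [DecidableEq γ]
    (M : Matrix (α × β × γ) (α × β × γ) ℂ) (Z : Matrix α α ℂ) :
    trace (Z * (of fun a a' => ∑ c, ptrMid M (a, c) (a', c))) =
      trace ((Z ⊗ₖ ((1 : Matrix β β ℂ) ⊗ₖ (1 : Matrix γ γ ℂ))) * M) := by
  simp only [trace, diag_apply, mul_apply, of_apply, ptrMid, Fintype.sum_prod_type,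
    kroneckerMap_apply, one_apply, mul_ite, ite_mul, mul_one, mul_zero, zero_mul, one_mul]
  refine Finset.sum_congr rfl fun a _ => ?_
  simp only [Finset.sum_ite_eq, Finset.mem_univ, if_true, Finset.mul_sum]
  calc _ = ∑ x, ∑ b, ∑ c, Z a x * M (x, b, c) (a, b, c) :=
        Finset.sum_congr rfl fun x _ => Finset.sum_comm
    _ = ∑ b, ∑ x, ∑ c, Z a x * M (x, b, c) (a, b, c) := Finset.sum_comm
    _ = _ := Finset.sum_congr rfl fun x _ => Finset.sum_comm

theorem ptrMid_psd {α β γ : Type*} [Fintype α] [DecidableEq α] [Fintype β] [DecidableEq β]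
    [Fintype γ] [DecidableEq γ]
    (M : Matrix (α × β × γ) (α × β × γ) ℂ) (hM : M.PosSemidef) : (ptrMid M).PosSemidef := by
  have : ptrMid M = ∑ b, M.submatrix (fun p : α × γ => (p.1, b, p.2)) (fun p : α × γ => (p.1, b, p.2)) := by
    ext p q
    rw [Matrix.sum_apply]; rfl
  rw [this]
  exact posSemidef_sum _ fun b _ => hM.submatrix _

theorem ptrMid_cyc {α β γ : Type*} [Fintype α] [DecidableEq α] [Fintype β] [DecidableEq β]
    [Fintype γ] [DecidableEq γ]
    (M : Matrix (α × β × γ) (α × β × γ) ℂ) (B : Matrix β β ℂ) :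
    ptrMid (((1 : Matrix α α ℂ) ⊗ₖ (B ⊗ₖ (1 : Matrix γ γ ℂ))) * M) =
    ptrMid (M * ((1 : Matrix α α ℂ) ⊗ₖ (B ⊗ₖ (1 : Matrix γ γ ℂ)))) := by
  ext ⟨a, c⟩ ⟨a', c'⟩
  simp only [mul_apply, ptrMid, Fintype.sum_prod_type,
    kroneckerMap_apply, one_apply, mul_ite, ite_mul, mul_one, mul_zero, zero_mul, one_mul,
    Finset.sum_ite_eq, Finset.sum_ite_eq', Finset.mem_univ, if_true, Finset.sum_ite_irrel,
    Finset.sum_const_zero]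
  rw [Finset.sum_comm]
  simp only [mul_comm]

open scoped Matrix.Norms.L2Operator MatrixOrder in
theorem psd_fac {Ω : Type*} [Fintype Ω] [DecidableEq Ω] (S : Matrix Ω Ω ℂ) (hS : S.PosSemidef) :
    ∃ B : Matrix Ω Ω ℂ, S = Bᴴ * B := by
  obtain ⟨B, hB⟩ := CStarAlgebra.nonneg_iff_eq_star_mul_self.1 hS.nonneg
  exact ⟨B, hB⟩

theorem ptrMid_mul_psd {α β γ : Type*} [Fintype α] [DecidableEq α] [Fintype β] [DecidableEq β]
    [Fintype γ] [DecidableEq γ]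
    (M : Matrix (α × β × γ) (α × β × γ) ℂ) (hM : M.PosSemidef) (S : Matrix β β ℂ)
    (hS : S.PosSemidef) :
    (ptrMid (((1 : Matrix α α ℂ) ⊗ₖ (S ⊗ₖ (1 : Matrix γ γ ℂ))) * M)).PosSemidef := by
  obtain ⟨B, rfl⟩ := psd_fac S hS
  have e : ((1 : Matrix α α ℂ) ⊗ₖ ((Bᴴ * B) ⊗ₖ (1 : Matrix γ γ ℂ))) =
      ((1 : Matrix α α ℂ) ⊗ₖ (Bᴴ ⊗ₖ (1 : Matrix γ γ ℂ))) *
      ((1 : Matrix α α ℂ) ⊗ₖ (B ⊗ₖ (1 : Matrix γ γ ℂ))) := by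
    rw [← mul_kronecker_mul, ← mul_kronecker_mul, one_mul, one_mul]
  rw [e, mul_assoc, ptrMid_cyc]
  apply ptrMid_psd
  have e2 : ((1 : Matrix α α ℂ) ⊗ₖ (Bᴴ ⊗ₖ (1 : Matrix γ γ ℂ))) =
      ((1 : Matrix α α ℂ) ⊗ₖ (B ⊗ₖ (1 : Matrix γ γ ℂ)))ᴴ := by
    rw [conjTranspose_kronecker, conjTranspose_kronecker, conjTranspose_one, conjTranspose_one]
  rw [e2]
  exact hM.mul_mul_conjTranspose_same _

theorem comb1_iff {α β γ : Type*} [Fintype α] [DecidableEq α] [Fintype β] [DecidableEq β]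
    [Fintype γ] [DecidableEq γ]
    (M : Matrix (α × β × γ) (α × β × γ) ℂ) (hM : M.PosSemidef) (S : Matrix β β ℂ)
    (hS : S.PosSemidef) :
    ptrMid (((1 : Matrix α α ℂ) ⊗ₖ (S ⊗ₖ (1 : Matrix γ γ ℂ))) * M) ∈ comb1Set α γ ↔
    ∀ Z, trace ((Z ⊗ₖ (S ⊗ₖ (1 : Matrix γ γ ℂ))) * M) = trace Z := by
  have e : ∀ Z : Matrix α α ℂ, (Z ⊗ₖ (S ⊗ₖ (1 : Matrix γ γ ℂ))) * M =
      (Z ⊗ₖ ((1 : Matrix β β ℂ) ⊗ₖ (1 : Matrix γ γ ℂ))) *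
      (((1 : Matrix α α ℂ) ⊗ₖ (S ⊗ₖ (1 : Matrix γ γ ℂ))) * M) := by
    intro Z
    rw [← mul_assoc, ← mul_kronecker_mul, ← mul_kronecker_mul, one_mul, one_mul, mul_one]
  have e' : ∀ Z : Matrix α α ℂ, trace ((Z ⊗ₖ (S ⊗ₖ (1 : Matrix γ γ ℂ))) * M) = _ := fun Z =>
    (congrArg trace (e Z)).trans (trace_ptr _ Z).symm
  simp only [e']
  constructor
  · rintro ⟨-, h⟩ Z
    have : (of fun a a' => ∑ c, ptrMid (((1 : Matrix α α ℂ) ⊗ₖ (S ⊗ₖ (1 : Matrix γ γ ℂ))) * M)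
      (a, c) (a', c)) = (1 : Matrix α α ℂ) := h
    rw [this, mul_one]
  · intro h
    refine ⟨ptrMid_mul_psd M hM S hS, ?_⟩
    apply Matrix.ext_iff_trace_mul_left.2
    intro Z
    rw [mul_one]
    exact h Z

theorem good_zero (H : ℕ → Type) [∀ j, Fintype (H j)] [∀ j, DecidableEq (H j)] (S) :
    Good 0 H S ↔ S = 1 := by
  have hsub : Unique (∀ j : Fin (2 * 0), H j) := Pi.uniqueOfIsEmpty (α := Fin 0) (fun j : Fin 0 => H j)
  constructor
  · rintro ⟨-, h, -⟩
    ext f g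
    have e : f = g := Subsingleton.elim _ _
    subst e
    rw [one_apply_eq]
    simp [nrm, trace] at h
    rw [← h]
    congr 1 <;> exact Subsingleton.elim _ _
  · rintro rfl
    refine ⟨PosSemidef.one, by simp [nrm], one_mem_VV _ _⟩

theorem comb_one_iff (H : ℕ → Type) [∀ j, Fintype (H j)] [∀ j, DecidableEq (H j)]
    (R : Matrix (∀ j : Fin 2, H j) (∀ j : Fin 2, H j) ℂ) :
    trLast 1 R = 1 ↔ ∀ Z, trace (tst H 0 Z 1 1 * R) = trace Z := by
  simp only [tst_pair, ← trace_ptr]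
  have e : (of fun a a' => (∑ c, ptrMid (reindex (splitEnds H 0) (splitEnds H 0) R) (a, c) (a', c))) =
      (reindex (Equiv.piUnique (fun j : Fin 1 => H j)) (Equiv.piUnique (fun j : Fin 1 => H j))
       (trLast 1 R) : Matrix (H 0) (H 0) ℂ) := by
    ext a a'
    rw [of_apply]
    unfold ptrMid trLast
    refine Finset.sum_congr rfl fun b _ => ?_
    rw [Fintype.sum_unique, reindex_apply, submatrix_apply]
    have h : ∀ (a : H 0) (x), (splitEnds H 0).symm (a, x, b) =
        Fin.snoc (α := fun j : Fin 2 => H j) (n := 1)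
          ((Equiv.piUnique (fun j : Fin 1 => H j)).symm a) b := by
      intro a x
      rw [Equiv.symm_apply_eq]
      refine Prod.ext rfl (Prod.ext (funext fun j => j.elim0) ?_)
      exact (Fin.snoc_last (α := fun j : Fin 2 => H j) (n := 1) b
        ((Equiv.piUnique (fun j : Fin 1 => H j)).symm a)).symm
    rw [h, h]
  rw [e]
  constructor
  · intro h Z
    rw [h]
    have : (reindex (Equiv.piUnique (fun j : Fin 1 => H j)) (Equiv.piUnique (fun j : Fin 1 => H j))
       1 : Matrix (H 0) (H 0) ℂ) = 1 := submatrix_one_equiv _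
    rw [this, mul_one]
  · intro h
    apply (reindex (Equiv.piUnique (fun j : Fin 1 => H j)) (Equiv.piUnique (fun j : Fin 1 => H j))).injective
    refine Eq.trans ?_ (submatrix_one_equiv (Equiv.piUnique (fun j : Fin 1 => H j)).symm).symm
    apply Matrix.ext_iff_trace_mul_left.2
    intro Z
    rw [mul_one]
    exact h Z

theorem comb_iff_good (n : ℕ) : ∀ (H : ℕ → Type) [∀ j, Fintype (H j)] [∀ j, DecidableEq (H j)]
    (_ : ∀ j < 2 * (n + 1), Nonempty (H j)) (R), R ∈ Comb (n + 1) H ↔ Good (n + 1) H R := by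
  induction n with
  | zero =>
    intro H _ _ hH R
    have h1 := dual_mp 0 H hH R
    have h2 := dual_mpr 0 H hH R
    have h3 := comb_one_iff H R
    constructor
    · rintro ⟨hR, h⟩
      have := h1 (fun S hS Z => by have := (good_zero (fun j => H (j + 1)) S).1 hS; subst this; exact h3.1 h Z)
      exact ⟨hR, this.1, this.2⟩
    · rintro ⟨hR, ha, hb⟩
      exact ⟨hR, h3.2 fun Z => h2 ha hb 1 ((good_zero _ _).2 rfl) Z⟩
  | succ n ih =>
    intro H _ _ hH R
    have h1 := dual_mp (n + 1) H hH R
    have h2 := dual_mpr (n + 1) H hH R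
    have ih := ih (fun j => H (j + 1)) (fun j hj => hH _ (by omega))
    simp only [tst_pair] at h1 h2
    constructor
    · rintro ⟨hR, h⟩
      have hR' : (reindex (splitEnds H (2 * (n + 1))) (splitEnds H (2 * (n + 1))) R).PosSemidef :=
        hR.submatrix _
      have := h1 (fun S hS => (comb1_iff _ hR' S hS.1).1 (h S ((ih S).2 hS)))
      exact ⟨hR, this.1, this.2⟩
    · rintro ⟨hR, ha, hb⟩
      have hR' : (reindex (splitEnds H (2 * (n + 1))) (splitEnds H (2 * (n + 1))) R).PosSemidef :=
        hR.submatrix _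
      refine ⟨hR, fun S hS => ?_⟩
      have hS := (ih S).1 hS
      exact (comb1_iff _ hR' S hS.1).2 (h2 ha hb S hS)

theorem comb_iff (n : ℕ) (hn : 1 ≤ n) (H : ℕ → Type) [∀ j, Fintype (H j)] [∀ j, DecidableEq (H j)]
    (hH : ∀ j < 2 * n, Nonempty (H j)) (R) : R ∈ Comb n H ↔ Good n H R := by
  obtain ⟨k, rfl⟩ : ∃ k, n = k + 1 := ⟨n - 1, by omega⟩
  exact comb_iff_good k H hH R

/-- the factor permutation -/
def Phi (m n : ℕ) (H : ℕ → Type) (σ : Equiv.Perm (Fin (m + n))) :=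
  (piFinCast H (by omega : 2 * m + 2 * n = 2 * (m + n))).trans (permEquiv H (toothReorder σ))

theorem Phi_apply (m n : ℕ) (H : ℕ → Type) (σ : Equiv.Perm (Fin (m + n)))
    (f : ∀ j : Fin (2 * m + 2 * n), H j) (j : Fin (2 * (m + n))) :
    Phi m n H σ f j = cast (congrArg H (by simp [extendPerm]))
      (f ⟨toothReorder σ j, by have := (toothReorder σ j).isLt; omega⟩) := rfl

theorem toothReorder_apply {p : ℕ} (σ : Equiv.Perm (Fin p)) (j : Fin (2 * p)) :
    (toothReorder σ j : ℕ) = 2 * (σ.symm ⟨j / 2, by omega⟩ : ℕ) + j % 2 := rfl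

theorem toothReorder_symm_apply {p : ℕ} (σ : Equiv.Perm (Fin p)) (j : Fin (2 * p)) :
    ((toothReorder σ).symm j : ℕ) = 2 * (σ ⟨j / 2, by omega⟩ : ℕ) + j % 2 := rfl

/-- position of a factor -/
def pos {m n : ℕ} (σ : Equiv.Perm (Fin (m + n))) (i : Fin (2 * m + 2 * n)) : ℕ :=
  2 * (σ ⟨i / 2, by omega⟩ : ℕ) + i % 2

theorem ED_Phi (m n : ℕ) (H : ℕ → Type) [∀ j, Fintype (H j)]
    (σ : Equiv.Perm (Fin (m + n))) (c : ℕ)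
    (R : Matrix (∀ j : Fin (2 * m + 2 * n), H j) (∀ j : Fin (2 * m + 2 * n), H j) ℂ) :
    ED (fun i => H (extendPerm (toothReorder σ) i)) (2 * (m + n)) c
      (reindex (Phi m n H σ) (Phi m n H σ) R) =
    reindex (Phi m n H σ) (Phi m n H σ)
      (Dep (pw (H := fun j : Fin (2 * m + 2 * n) => H j) {i | c ≤ pos σ i}) R) := by
  apply Dep_reindex
  intro a b
  funext j
  have hj : pos σ ⟨toothReorder σ j, by have := (toothReorder σ j).isLt; omega⟩ = (j : ℕ) := by
    have := toothReorder_symm_apply σ (toothReorder σ j)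
    rw [Equiv.symm_apply_apply] at this
    rw [this]; rfl
  by_cases h : c ≤ (j : ℕ)
  · rw [pw_of_mem _ _ (by exact h), Phi_apply, Phi_apply, pw_of_mem]
    simpa [hj] using h
  · rw [pw_of_not_mem _ _ (by exact h), Phi_apply, Phi_apply, pw_of_not_mem]
    simpa [hj] using h

theorem nrm_Phi (m n : ℕ) (H : ℕ → Type) [∀ j, Fintype (H j)]
    (σ : Equiv.Perm (Fin (m + n))) :
    nrm (m + n) (fun i => H (extendPerm (toothReorder σ) i)) =
      nrm m H * nrm n (fun i => H (2 * m + i)) := by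
  unfold nrm
  have h : ∀ k : Fin (m + n), extendPerm (toothReorder σ) (2 * (k : ℕ)) = 2 * (σ.symm k : ℕ) := by
    intro k
    rw [extendPerm, dif_pos (by omega), toothReorder_apply]
    simp
  have h2 : ∀ k : Fin (m + n), (Fintype.card (H (extendPerm (toothReorder σ) (2 * (k : ℕ)))) : ℂ) =
      Fintype.card (H (2 * (σ.symm k : ℕ))) := by
    intro k
    congr 1
    exact Fintype.card_congr (Equiv.cast (congrArg H (h k)))
  simp only [h2]
  rw [Equiv.prod_comp σ.symm (fun k => (Fintype.card (H (2 * (k : ℕ))) : ℂ)), Fin.prod_univ_add]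
  congr 1
  refine Finset.prod_congr rfl fun k _ => ?_
  congr 1
  exact Fintype.card_congr (Equiv.cast (congrArg H (by simp [mul_add])))

theorem Kset_iff (m n : ℕ) (hm : 1 ≤ m) (H : ℕ → Type) [∀ j, Fintype (H j)] [∀ j, DecidableEq (H j)]
    (hH : ∀ j < 2 * m + 2 * n, Nonempty (H j))
    (σ : Equiv.Perm (Fin (m + n)))
    (R : Matrix (∀ j : Fin (2 * m + 2 * n), H j) (∀ j : Fin (2 * m + 2 * n), H j) ℂ) :
    R ∈ Kset m n H σ ↔ R.PosSemidef ∧ trace R = nrm m H * nrm n (fun i => H (2 * m + i)) ∧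
      ∀ k < m + n, Dep (pw (H := fun j : Fin (2 * m + 2 * n) => H j) {i | 2 * k + 1 ≤ pos σ i}) R =
        Dep (pw (H := fun j : Fin (2 * m + 2 * n) => H j) {i | 2 * k ≤ pos σ i}) R := by
  have hH' : ∀ j < 2 * (m + n), Nonempty (H (extendPerm (toothReorder σ) j)) := by
    intro j hj
    apply hH
    rw [extendPerm, dif_pos hj]
    have := (toothReorder σ ⟨j, hj⟩).isLt
    omega
  change (R.PosSemidef ∧ reindex (Phi m n H σ) (Phi m n H σ) R ∈
    Comb (m + n) (fun i => H (extendPerm (toothReorder σ) i))) ↔ _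
  rw [comb_iff (m + n) (by omega) _ hH', Good, trace_reindex_self, nrm_Phi, mem_VV]
  simp only [ED_Phi, EmbeddingLike.apply_eq_iff_eq]
  have : R.PosSemidef → (reindex (Phi m n H σ) (Phi m n H σ) R).PosSemidef := fun h => h.submatrix _
  tauto

/-- block-tail conditions -/
def UC (m n : ℕ) (H : ℕ → Type) [∀ j, Fintype (H j)]
    (R : Matrix (∀ j : Fin (2 * m + 2 * n), H j) (∀ j : Fin (2 * m + 2 * n), H j) ℂ) : Prop :=
  (∀ k < m, Dep (pw (H := fun j : Fin (2 * m + 2 * n) => H j)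
      {i | 2 * k + 1 ≤ (i : ℕ) ∧ (i : ℕ) < 2 * m}) R =
    Dep (pw (H := fun j : Fin (2 * m + 2 * n) => H j) {i | 2 * k ≤ (i : ℕ) ∧ (i : ℕ) < 2 * m}) R) ∧
  (∀ k < n, Dep (pw (H := fun j : Fin (2 * m + 2 * n) => H j) {i | 2 * m + (2 * k + 1) ≤ (i : ℕ)}) R =
    Dep (pw (H := fun j : Fin (2 * m + 2 * n) => H j) {i | 2 * m + 2 * k ≤ (i : ℕ)}) R)

/-- shuffles -/
def IsShuf (m n : ℕ) (σ : Equiv.Perm (Fin (m + n))) : Prop :=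
  (∀ i j : Fin (m + n), i < j → (j : ℕ) < m → σ i < σ j) ∧
  (∀ i j : Fin (m + n), i < j → m ≤ (i : ℕ) → σ i < σ j)

theorem isShuf_one (m n : ℕ) : IsShuf m n 1 :=
  ⟨fun _ _ h _ => h, fun _ _ h _ => h⟩

/-- B before A -/
def sBA (m n : ℕ) : Equiv.Perm (Fin (m + n)) := finAddFlip.trans (finCongr (Nat.add_comm n m))

theorem sBA_lt (m n : ℕ) (i : Fin (m + n)) (h : (i : ℕ) < m) : (sBA m n i : ℕ) = n + i := by
  obtain ⟨i, hi⟩ := i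
  simp only [sBA, Equiv.trans_apply, finAddFlip_apply_mk_left h]
  rfl

theorem sBA_ge (m n : ℕ) (i : Fin (m + n)) (h : m ≤ (i : ℕ)) : (sBA m n i : ℕ) = i - m := by
  obtain ⟨i, hi⟩ := i
  simp only [sBA, Equiv.trans_apply, finAddFlip_apply_mk_right h hi]
  rfl

theorem isShuf_sBA (m n : ℕ) : IsShuf m n (sBA m n) := by
  constructor
  · intro i j h hj
    have h : (i : ℕ) < j := h
    rw [Fin.lt_def, sBA_lt _ _ _ hj, sBA_lt _ _ _ (by omega)]; omega
  · intro i j h hj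
    have h : (i : ℕ) < j := h
    rw [Fin.lt_def, sBA_ge _ _ _ hj, sBA_ge _ _ _ (by omega)]; omega

theorem UC_of_shuf (m n : ℕ) (H : ℕ → Type) [∀ j, Fintype (H j)]
    (R : Matrix (∀ j : Fin (2 * m + 2 * n), H j) (∀ j : Fin (2 * m + 2 * n), H j) ℂ)
    (h : ∀ σ, IsShuf m n σ → ∀ k < m + n,
      Dep (pw (H := fun j : Fin (2 * m + 2 * n) => H j) {i | 2 * k + 1 ≤ pos σ i}) R =
        Dep (pw (H := fun j : Fin (2 * m + 2 * n) => H j) {i | 2 * k ≤ pos σ i}) R) :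
    UC m n H R := by
  constructor
  · intro k hk
    have hs := h _ (isShuf_sBA m n) (n + k) (by omega)
    have e : ∀ c d, d = 2 * n + c → {i : Fin (2 * m + 2 * n) | d ≤ pos (sBA m n) i} =
        {i : Fin (2 * m + 2 * n) | c ≤ (i : ℕ) ∧ (i : ℕ) < 2 * m} := by
      intro c d hd
      ext i
      simp only [Set.mem_ofPred_eq, pos]
      rcases lt_or_ge (i : ℕ) (2 * m) with hi | hi
      · rw [sBA_lt _ _ _ (by simp only []; omega)]
        simp only []
        omega
      · rw [sBA_ge _ _ _ (by simp only []; omega)]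
        simp only []
        have := i.isLt
        omega
    rwa [e (2 * k + 1) _ (by ring), e (2 * k) _ (by ring)] at hs
  · intro k hk
    have hs := h _ (isShuf_one m n) (m + k) (by omega)
    have e : ∀ c, {i : Fin (2 * m + 2 * n) | c ≤ pos (m := m) (n := n) 1 i} = {i : Fin (2 * m + 2 * n) | c ≤ (i : ℕ)} := by
      intro c
      ext i
      simp only [Set.mem_ofPred_eq, pos, Equiv.Perm.one_apply]
      omega
    rw [e, e, mul_add, add_assoc] at hs
    exact hs

theorem shuf_of_UC (m n : ℕ) (H : ℕ → Type) [∀ j, Fintype (H j)]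
    (R : Matrix (∀ j : Fin (2 * m + 2 * n), H j) (∀ j : Fin (2 * m + 2 * n), H j) ℂ)
    (h : UC m n H R) (σ) (hσ : IsShuf m n σ) (k : ℕ) (hk : k < m + n) :
      Dep (pw (H := fun j : Fin (2 * m + 2 * n) => H j) {i | 2 * k + 1 ≤ pos σ i}) R =
        Dep (pw (H := fun j : Fin (2 * m + 2 * n) => H j) {i | 2 * k ≤ pos σ i}) R := by
  obtain ⟨t, ht⟩ : ∃ t, σ t = ⟨k, hk⟩ := ⟨σ.symm ⟨k, hk⟩, by simp⟩
  have ht' : (σ t : ℕ) = k := by rw [ht]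
  set K := {i : Fin (2 * m + 2 * n) | 2 * k + 1 ≤ pos σ i} with hK
  have main : ∀ J J' : Set (Fin (2 * m + 2 * n)),
      Dep (pw (H := fun j : Fin (2 * m + 2 * n) => H j) J) R =
        Dep (pw (H := fun j : Fin (2 * m + 2 * n) => H j) J') R →
      J ⊆ K → (∀ i, i ∈ J' ↔ i ∈ J ∨ (i : ℕ) = 2 * t) → 
      Dep (pw (H := fun j : Fin (2 * m + 2 * n) => H j) K) R =
        Dep (pw (H := fun j : Fin (2 * m + 2 * n) => H j) {i | 2 * k ≤ pos σ i}) R := by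
    intro J J' hJ h1 h2
    have := congrArg (Dep (pw (H := fun j : Fin (2 * m + 2 * n) => H j) K)) hJ
    rw [Dep_pw_comp, Dep_pw_comp] at this
    rw [Set.union_eq_left.2 h1] at this
    rw [this]
    congr 3
    ext i
    simp only [Set.mem_union, h2, Set.mem_ofPred_eq, hK]
    have hp : (i : ℕ) = 2 * t ↔ pos σ i = 2 * k := by
      constructor
      · intro hi
        have e : (⟨i / 2, by omega⟩ : Fin (m + n)) = t := Fin.ext (by simp only []; omega)
        rw [pos, e, ht']; omega
      · intro hi
        have e : σ (⟨i / 2, by omega⟩ : Fin (m + n)) = σ t := by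
          apply Fin.ext; rw [ht']; unfold pos at hi; omega
        have e := congrArg Fin.val (σ.injective e)
        simp only [] at e
        unfold pos at hi; omega
    have h1' : i ∈ J → 2 * k + 1 ≤ pos σ i := fun hi => h1 hi
    rw [hp]
    constructor
    · rintro (h | h | h)
      · omega
      · have := h1' h; omega
      · omega
    · intro h
      rcases eq_or_lt_of_le h with h | h
      · exact Or.inr (Or.inr h.symm)
      · exact Or.inl h
  rcases lt_or_ge (t : ℕ) m with htm | htm
  · refine main _ _ (h.1 t htm) ?_ ?_
    · intro i hi
      simp only [Set.mem_ofPred_eq, hK, pos] at hi ⊢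
      rcases eq_or_lt_of_le hi.1 with h1 | h1
      · have e : (⟨i / 2, by omega⟩ : Fin (m + n)) = t := Fin.ext (by simp only []; omega)
        rw [e, ht']; omega
      · have := hσ.1 t ⟨i / 2, by omega⟩ (by rw [Fin.lt_def]; simp only []; omega) (by simp only []; omega)
        rw [Fin.lt_def, ht'] at this
        omega
    · intro i; simp only [Set.mem_ofPred_eq]; omega
  · refine main _ _ (h.2 (t - m) (by omega)) ?_ ?_
    · intro i hi
      simp only [Set.mem_ofPred_eq, hK, pos] at hi ⊢
      rcases eq_or_lt_of_le hi with h1 | h1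
      · have e : (⟨i / 2, by omega⟩ : Fin (m + n)) = t := Fin.ext (by simp only []; omega)
        rw [e, ht']; omega
      · have := hσ.2 t ⟨i / 2, by omega⟩ (by rw [Fin.lt_def]; simp only []; omega) htm
        rw [Fin.lt_def, ht'] at this
        omega
    · intro i; simp only [Set.mem_ofPred_eq]; omega

theorem mem_inter_iff (m n : ℕ) (hm : 1 ≤ m) (H : ℕ → Type) [∀ j, Fintype (H j)] [∀ j, DecidableEq (H j)]
    (hH : ∀ j < 2 * m + 2 * n, Nonempty (H j))
    (R : Matrix (∀ j : Fin (2 * m + 2 * n), H j) (∀ j : Fin (2 * m + 2 * n), H j) ℂ) :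
    (∀ σ, IsShuf m n σ → R ∈ Kset m n H σ) ↔
     R.PosSemidef ∧ trace R = nrm m H * nrm n (fun i => H (2 * m + i)) ∧ UC m n H R := by
  simp only [Kset_iff m n hm H hH]
  constructor
  · intro h
    have := h _ (isShuf_one m n)
    exact ⟨this.1, this.2.1, UC_of_shuf m n H R fun σ hσ => (h σ hσ).2.2⟩
  · rintro ⟨h1, h2, h3⟩ σ hσ
    exact ⟨h1, h2, shuf_of_UC m n H R h3 σ hσ⟩

/-- depolarize the tail of block A -/
def DA (m n : ℕ) (H : ℕ → Type) [∀ j, Fintype (H j)] (c : ℕ) :=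
  Dep (prodBand (pw (H := fun j : Fin (2 * m) => H j) {j | c ≤ (j : ℕ)})
    (fun _ (b : ∀ j : Fin (2 * n), H (2 * m + j)) => b))

/-- depolarize the tail of block B -/
def DB (m n : ℕ) (H : ℕ → Type) [∀ j, Fintype (H j)] (c : ℕ) :=
  Dep (prodBand (fun _ (b : ∀ j : Fin (2 * m), H j) => b)
    (pw (H := fun j : Fin (2 * n) => H (2 * m + j)) {j | c ≤ (j : ℕ)}))

theorem DA_eq (m n : ℕ) (H : ℕ → Type) [∀ j, Fintype (H j)] (c : ℕ)
    (R : Matrix (∀ j : Fin (2 * m + 2 * n), H j) (∀ j : Fin (2 * m + 2 * n), H j) ℂ) :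
    DA m n H c (reindex (splitPi (2 * m) (2 * n) H) (splitPi (2 * m) (2 * n) H) R) =
    reindex (splitPi (2 * m) (2 * n) H) (splitPi (2 * m) (2 * n) H)
     (Dep (pw (H := fun j : Fin (2 * m + 2 * n) => H j) {i | c ≤ (i : ℕ) ∧ (i : ℕ) < 2 * m}) R) := by
  apply Dep_reindex
  intro a b
  refine Prod.ext ?_ ?_
  · funext j
    by_cases hj : c ≤ (j : ℕ)
    · refine Eq.trans ?_ (pw_of_mem _ _ (H := fun j : Fin (2 * m) => H j) (i := j) (J := {j : Fin (2 * m) | c ≤ (j : ℕ)}) hj).symm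
      exact pw_of_mem a b (by simp [hj])
    · refine Eq.trans ?_ (pw_of_not_mem _ _ (H := fun j : Fin (2 * m) => H j) (i := j) (J := {j : Fin (2 * m) | c ≤ (j : ℕ)}) hj).symm
      exact pw_of_not_mem a b (by simp [hj])
  · funext j
    exact pw_of_not_mem a b (by simp)

theorem DB_eq (m n : ℕ) (H : ℕ → Type) [∀ j, Fintype (H j)] (c : ℕ)
    (R : Matrix (∀ j : Fin (2 * m + 2 * n), H j) (∀ j : Fin (2 * m + 2 * n), H j) ℂ) :
    DB m n H c (reindex (splitPi (2 * m) (2 * n) H) (splitPi (2 * m) (2 * n) H) R) =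
    reindex (splitPi (2 * m) (2 * n) H) (splitPi (2 * m) (2 * n) H)
     (Dep (pw (H := fun j : Fin (2 * m + 2 * n) => H j) {i | 2 * m + c ≤ (i : ℕ)}) R) := by
  apply Dep_reindex
  intro a b
  refine Prod.ext ?_ ?_
  · funext j
    exact pw_of_not_mem a b (by simp; omega)
  · funext j
    by_cases hj : c ≤ (j : ℕ)
    · refine Eq.trans ?_ (pw_of_mem _ _ (H := fun j : Fin (2 * n) => H (2 * m + j)) (i := j) (J := {j : Fin (2 * n) | c ≤ (j : ℕ)}) hj).symm
      exact pw_of_mem a b (by simp [hj])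
    · refine Eq.trans ?_ (pw_of_not_mem _ _ (H := fun j : Fin (2 * n) => H (2 * m + j)) (i := j) (J := {j : Fin (2 * n) | c ≤ (j : ℕ)}) hj).symm
      exact pw_of_not_mem a b (by simp; omega)

theorem UC_iff (m n : ℕ) (H : ℕ → Type) [∀ j, Fintype (H j)]
    (R : Matrix (∀ j : Fin (2 * m + 2 * n), H j) (∀ j : Fin (2 * m + 2 * n), H j) ℂ) (R')
    (hR : R' = reindex (splitPi (2 * m) (2 * n) H) (splitPi (2 * m) (2 * n) H) R) :
    UC m n H R ↔ (∀ k < m, DA m n H (2 * k + 1) R' = DA m n H (2 * k) R') ∧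
      (∀ k < n, DB m n H (2 * k + 1) R' = DB m n H (2 * k) R') := by
  subst hR
  simp only [DA_eq, DB_eq, EmbeddingLike.apply_eq_iff_eq]
  rfl

theorem kron_DA (m n : ℕ) (H : ℕ → Type) [∀ j, Fintype (H j)] (M) (hM : M ∈ VV m H) (N) :
    (∀ k < m, DA m n H (2 * k + 1) (M ⊗ₖ N) = DA m n H (2 * k) (M ⊗ₖ N)) := by
  intro k hk
  rw [DA, DA, Dep_kron, Dep_kron]
  exact congrArg (· ⊗ₖ _) (hM k hk)

theorem kron_DB (m n : ℕ) (H : ℕ → Type) [∀ j, Fintype (H j)] (M) (N)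
    (hN : N ∈ VV n (fun i => H (2 * m + i))) :
    (∀ k < n, DB m n H (2 * k + 1) (M ⊗ₖ N) = DB m n H (2 * k) (M ⊗ₖ N)) := by
  intro k hk
  rw [DB, DB, Dep_kron, Dep_kron]
  exact congrArg (_ ⊗ₖ ·) (hN k hk)

theorem aff_sub (m n : ℕ) (H : ℕ → Type) [∀ j, Fintype (H j)] (R')
    (h : R' ∈ affineSpan ℝ (Set.image2 (· ⊗ₖ ·) {M | Good m H M}
      {N | Good n (fun i => H (2 * m + i)) N})) :
    trace R' = nrm m H * nrm n (fun i => H (2 * m + i)) ∧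
     (∀ k < m, DA m n H (2 * k + 1) R' = DA m n H (2 * k) R') ∧
      (∀ k < n, DB m n H (2 * k + 1) R' = DB m n H (2 * k) R') := by
  refine affineSpan_induction (p := fun R' => trace R' = nrm m H * nrm n (fun i => H (2 * m + i)) ∧
     (∀ k < m, DA m n H (2 * k + 1) R' = DA m n H (2 * k) R') ∧
      (∀ k < n, DB m n H (2 * k + 1) R' = DB m n H (2 * k) R')) h ?_ ?_
  · intro x hx
    obtain ⟨M, hM, N, hN, rfl⟩ := hx
    simp only []
    refine ⟨?_, kron_DA m n H M hM.2.2 N, kron_DB m n H M N hN.2.2⟩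
    rw [trace_kronecker, hM.2.1, hN.2.1]
  · intro c u v w hu hv hw
    simp only [vsub_eq_sub, vadd_eq_add]
    refine ⟨?_, fun k hk => ?_, fun k hk => ?_⟩
    · rw [trace_add, trace_smul, trace_sub, hu.1, hv.1, hw.1, sub_self, smul_zero, zero_add]
    · simp only [map_add, LinearMap.map_smul_of_tower, map_sub, hu.2.1 k hk, hv.2.1 k hk, hw.2.1 k hk]
    · simp only [map_add, LinearMap.map_smul_of_tower, map_sub, hu.2.2 k hk, hv.2.2 k hk, hw.2.2 k hk]

theorem slice_A (m n : ℕ) (H : ℕ → Type) [∀ j, Fintype (H j)] (R')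
    (h : ∀ k < m, DA m n H (2 * k + 1) R' = DA m n H (2 * k) R') (b b') :
    (of fun a a' => R' (a, b) (a', b')) ∈ VV m H := by
  intro k hk
  ext a a'
  have := congrFun (congrFun (h k hk) (a, b)) (a', b')
  rw [DA, DA, Dep_prod_snd, Dep_prod_snd] at this
  exact this

theorem slice_B (m n : ℕ) (H : ℕ → Type) [∀ j, Fintype (H j)] (R')
    (h : ∀ k < n, DB m n H (2 * k + 1) R' = DB m n H (2 * k) R') (a a') :
    (of fun b b' => R' (a, b) (a', b')) ∈ VV n (fun i => H (2 * m + i)) := by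
  intro k hk
  ext b b'
  have := congrFun (congrFun (h k hk) (a, b)) (a', b')
  rw [DB, DB, Dep_snd_prod, Dep_snd_prod] at this
  exact this

theorem proj_exists {V : Type*} [AddCommGroup V] [Module ℂ V] (W : Submodule ℂ V) :
    ∃ π : V →ₗ[ℂ] V, (∀ x, π x ∈ W) ∧ ∀ x ∈ W, π x = x := by
  obtain ⟨g, hg⟩ := LinearMap.exists_extend (p := W) (LinearMap.id : W →ₗ[ℂ] W)
  refine ⟨W.subtype ∘ₗ g, fun x => (g x).2, fun x hx => ?_⟩
  have := LinearMap.congr_fun hg ⟨x, hx⟩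
  simp only [LinearMap.comp_apply, Submodule.subtype_apply, LinearMap.id_apply] at this ⊢
  rw [this]

theorem tensor_decomp {α β : Type*} [Fintype α] [Fintype β] 
    (V : Submodule ℂ (Matrix α α ℂ)) (W : Submodule ℂ (Matrix β β ℂ))
    (R : Matrix (α × β) (α × β) ℂ)
    (hV : ∀ b b', (of fun a a' => R (a, b) (a', b')) ∈ V)
    (hW : ∀ a a', (of fun b b' => R (a, b) (a', b')) ∈ W) :
    R ∈ Submodule.span ℂ (Set.image2 (· ⊗ₖ ·) (V : Set (Matrix α α ℂ)) (W : Set (Matrix β β ℂ))) := by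
  classical
  obtain ⟨π, h1, h2⟩ := proj_exists W
  have : R = ∑ b, ∑ b', (of fun a a' => R (a, b) (a', b')) ⊗ₖ π (single b b' 1) := by
    ext ⟨a, c⟩ ⟨a', c'⟩
    have e : (of fun b b' => R (a, b) (a', b')) = ∑ b, ∑ b', R (a, b) (a', b') • single b b' (1 : ℂ) := by
      conv_lhs => rw [matrix_eq_sum_single (of fun b b' => R (a, b) (a', b'))]
      simp
    have e2 := h2 _ (hW a a')
    rw [e] at e2
    simp only [map_sum, map_smul] at e2
    rw [← e] at e2
    have := congrFun (congrFun e2 c) c'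
    simp only [Matrix.sum_apply, Matrix.smul_apply, of_apply, smul_eq_mul] at this
    simp only [Matrix.sum_apply, kroneckerMap_apply, of_apply, this]
  rw [this]
  exact Submodule.sum_mem _ fun b _ => Submodule.sum_mem _ fun b' _ =>
    Submodule.subset_span ⟨_, hV b b', _, h1 _, rfl⟩

theorem span_kron {α β : Type*} [Fintype α] [Fintype β] 
    (V : Set (Matrix α α ℂ)) (W : Set (Matrix β β ℂ)) :
    Submodule.span ℂ (Set.image2 (· ⊗ₖ ·) (Submodule.span ℂ V : Set (Matrix α α ℂ))
      (Submodule.span ℂ W : Set (Matrix β β ℂ))) ≤ Submodule.span ℂ (Set.image2 (· ⊗ₖ ·) V W) := by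
  rw [Submodule.span_le]
  rintro _ ⟨M, hM, N, hN, rfl⟩
  simp only [SetLike.mem_coe] at hM hN ⊢
  induction hM using Submodule.span_induction with
  | mem M hM =>
    induction hN using Submodule.span_induction with
    | mem N hN => exact Submodule.subset_span ⟨M, hM, N, hN, rfl⟩
    | zero => rw [kronecker_zero]; exact Submodule.zero_mem _
    | add x y _ _ hx hy => rw [kronecker_add]; exact Submodule.add_mem _ hx hy
    | smul c x _ hx => rw [kronecker_smul]; exact Submodule.smul_mem _ _ hx
  | zero => rw [zero_kronecker]; exact Submodule.zero_mem _
  | add x y _ _ hx hy => rw [add_kronecker]; exact Submodule.add_mem _ hx hy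
  | smul c x _ hx => rw [smul_kronecker]; exact Submodule.smul_mem _ _ hx

theorem herm_real_span {Ω : Type*} [Fintype Ω] (S : Set (Matrix Ω Ω ℂ)) (hS : ∀ X ∈ S, Xᴴ = X)
    (R) (hR : R ∈ Submodule.span ℂ S) (hR' : Rᴴ = R) : R ∈ Submodule.span ℝ S := by
  have hh : ∀ x ∈ Submodule.span ℝ S, xᴴ = x := by
    intro x hx
    induction hx using Submodule.span_induction with
    | mem x hx => exact hS x hx
    | zero => simp
    | add x y _ _ hx hy => rw [conjTranspose_add, hx, hy]
    | smul c x _ hx => rw [conjTranspose_smul, hx]; simp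
  have key : ∀ x ∈ Submodule.span ℂ S, ∃ a ∈ Submodule.span ℝ S, ∃ b ∈ Submodule.span ℝ S,
      x = a + Complex.I • b := by
    intro x hx
    induction hx using Submodule.span_induction with
    | mem x hx => exact ⟨x, Submodule.subset_span hx, 0, Submodule.zero_mem _, by simp⟩
    | zero => exact ⟨0, Submodule.zero_mem _, 0, Submodule.zero_mem _, by simp⟩
    | add x y _ _ hx hy =>
      obtain ⟨a, ha, b, hb, rfl⟩ := hx
      obtain ⟨a', ha', b', hb', rfl⟩ := hy
      exact ⟨a + a', Submodule.add_mem _ ha ha', b + b', Submodule.add_mem _ hb hb', by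
        rw [smul_add]; abel⟩
    | smul c x _ hx =>
      obtain ⟨a, ha, b, hb, rfl⟩ := hx
      refine ⟨c.re • a - c.im • b, Submodule.sub_mem _ (Submodule.smul_mem _ _ ha)
        (Submodule.smul_mem _ _ hb), c.im • a + c.re • b, Submodule.add_mem _ (Submodule.smul_mem _ _ ha)
        (Submodule.smul_mem _ _ hb), ?_⟩
      ext i j
      simp only [Matrix.smul_apply, Matrix.add_apply, Matrix.sub_apply, smul_eq_mul, Complex.real_smul]
      conv_lhs => rw [← Complex.re_add_im c]
      linear_combination (-(c.im : ℂ) * b i j) * (-Complex.I_sq)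
  obtain ⟨a, ha, b, hb, rfl⟩ := key R hR
  rw [conjTranspose_add, conjTranspose_smul, hh a ha, hh b hb] at hR'
  have : b = 0 := by
    ext i j
    have := congrFun (congrFun hR' i) j
    simp at this
    have h2 : Complex.I * b i j = 0 := by linear_combination (-1/2 : ℂ) * this
    simpa using h2
  rw [this, smul_zero, add_zero]
  exact ha

theorem affine_of_span {V : Type*} [AddCommGroup V] [Module ℝ V] (S : Set V) (f : V →ₗ[ℝ] ℂ) (c : ℂ)
    (hc : c ≠ 0)
    (hf : ∀ x ∈ S, f x = c) (p : V) (hp : p ∈ S) (x : V) (hx : x ∈ Submodule.span ℝ S) (hfx : f x = c) :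
    x ∈ affineSpan ℝ S := by
  have key : ∀ y ∈ Submodule.span ℝ S, ∃ t : ℝ, f y = t * c ∧ y - t • p ∈ vectorSpan ℝ S := by
    intro y hy
    induction hy using Submodule.span_induction with
    | mem y hy =>
      refine ⟨1, by rw [hf y hy]; simp, ?_⟩
      rw [one_smul]
      exact vsub_mem_vectorSpan ℝ hy hp
    | zero => exact ⟨0, by simp, by simp⟩
    | add x y _ _ hx hy =>
      obtain ⟨t, h1, h2⟩ := hx
      obtain ⟨t', h1', h2'⟩ := hy
      refine ⟨t + t', by rw [map_add, h1, h1']; push_cast; ring, ?_⟩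
      have := Submodule.add_mem _ h2 h2'
      convert this using 1
      rw [add_smul]; abel
    | smul r x _ hx =>
      obtain ⟨t, h1, h2⟩ := hx
      refine ⟨r * t, by rw [map_smul, h1]; push_cast; rw [Complex.real_smul]; ring, ?_⟩
      have := Submodule.smul_mem _ r h2
      convert this using 1
      rw [smul_sub, mul_smul]
  obtain ⟨t, h1, h2⟩ := key x hx
  have ht : t = 1 := by
    rw [hfx] at h1
    have : (t : ℂ) = 1 := mul_right_cancel₀ hc (by rw [one_mul]; exact h1.symm)
    exact_mod_cast this
  subst ht
  rw [one_smul] at h2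
  have := AffineSubspace.vadd_mem_of_mem_direction (s := affineSpan ℝ S) (v := x - p)
    (by rw [direction_affineSpan]; exact h2) (subset_affineSpan ℝ S hp)
  simpa using this

theorem good_exists (n : ℕ) (H : ℕ → Type) [∀ j, Fintype (H j)] [∀ j, DecidableEq (H j)]
    (hH : ∀ j < 2 * n, Nonempty (H j)) : ∃ R, Good n H R := by
  have := pi_nonempty hH
  refine ⟨(nrm n H * (Fintype.card (∀ j : Fin (2 * n), H j) : ℂ)⁻¹) • 1, ?_, ?_, ?_⟩
  · apply PosSemidef.smul PosSemidef.one
    apply mul_nonneg (nrm_pos n H hH).le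
    have : (0 : ℂ) ≤ Fintype.card (∀ j : Fin (2 * n), H j) := by exact_mod_cast Nat.zero_le _
    exact inv_nonneg.2 this
  · rw [trace_smul, trace_one, smul_eq_mul, mul_assoc, inv_mul_cancel₀, mul_one]
    exact_mod_cast Fintype.card_ne_zero
  · exact Submodule.smul_mem _ _ (one_mem_VV _ _)

theorem aff_sup (m n : ℕ) (H : ℕ → Type) [∀ j, Fintype (H j)] [∀ j, DecidableEq (H j)]
    (hH : ∀ j < 2 * m + 2 * n, Nonempty (H j)) (R') (hR : R'.PosSemidef)
    (h0 : trace R' = nrm m H * nrm n (fun i => H (2 * m + i)))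
    (h1 : ∀ k < m, DA m n H (2 * k + 1) R' = DA m n H (2 * k) R')
    (h2 : ∀ k < n, DB m n H (2 * k + 1) R' = DB m n H (2 * k) R') :
    R' ∈ affineSpan ℝ (Set.image2 (· ⊗ₖ ·) {M | Good m H M}
      {N | Good n (fun i => H (2 * m + i)) N}) := by
  have hA : ∀ j < 2 * m, Nonempty (H j) := fun j hj => hH j (by omega)
  have hB : ∀ j < 2 * n, Nonempty (H (2 * m + j)) := fun j hj => hH _ (by omega)
  obtain ⟨M, hM⟩ := good_exists m H hA
  obtain ⟨N, hN⟩ := good_exists n (fun i => H (2 * m + i)) hB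
  have s1 := tensor_decomp (VV m H) (VV n (fun i => H (2 * m + i))) R' (slice_A m n H R' h1)
    (slice_B m n H R' h2)
  have s2 := span_kron {M | Good m H M} {N | Good n (fun i => H (2 * m + i)) N}
    (Submodule.span_mono (Set.image2_subset (VV_le_span hA) (VV_le_span hB)) s1)
  have s3 := herm_real_span _ (by
    rintro _ ⟨M, hM, N, hN, rfl⟩
    rw [conjTranspose_kronecker, hM.1.isHermitian.eq, hN.1.isHermitian.eq]) R' s2 hR.isHermitian.eq
  refine affine_of_span (Set.image2 (· ⊗ₖ ·) {M | Good m H M}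
      {N | Good n (fun i => H (2 * m + i)) N}) (traceLinearMap _ ℝ ℂ) (nrm m H * nrm n (fun i => H (2 * m + i)))
    (mul_ne_zero (nrm_pos m H hA).ne' (nrm_pos n _ hB).ne') ?_ (M ⊗ₖ N) ⟨M, hM, N, hN, rfl⟩ R' s3 h0
  rintro _ ⟨M, hM, N, hN, rfl⟩
  rw [traceLinearMap_apply, trace_kronecker, hM.2.1, hN.2.1]

theorem main_nondeg (m n : ℕ) (hm : 1 ≤ m) (hn : 1 ≤ n) (H : ℕ → Type)
    [∀ j, Fintype (H j)] [∀ j, DecidableEq (H j)]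
    (hH : ∀ j < 2 * m + 2 * n, Nonempty (H j))
    (R : Matrix (∀ j : Fin (2 * m + 2 * n), H j) (∀ j : Fin (2 * m + 2 * n), H j) ℂ) :
    (R.PosSemidef ∧
      Matrix.reindex (splitPi (2 * m) (2 * n) H) (splitPi (2 * m) (2 * n) H) R ∈
        affineSpan ℝ (Set.image2 (· ⊗ₖ ·) (Comb m H) (Comb n (fun i => H (2 * m + i))))) ↔
    ∀ σ, IsShuf m n σ → R ∈ Kset m n H σ := by
  rw [mem_inter_iff m n hm H hH]
  have e1 : Comb m H = {M | Good m H M} :=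
    Set.ext fun M => comb_iff m hm H (fun j hj => hH j (by omega)) M
  have e2 : Comb n (fun i => H (2 * m + i)) = {N | Good n (fun i => H (2 * m + i)) N} :=
    Set.ext fun N => comb_iff n hn _ (fun j hj => hH _ (by omega)) N
  rw [e1, e2, UC_iff m n H R _ rfl, ← trace_reindex_self (splitPi (2 * m) (2 * n) H) R]
  constructor
  · rintro ⟨h1, h2⟩
    exact ⟨h1, aff_sub m n H _ h2⟩
  · rintro ⟨h1, h2, h3, h4⟩
    exact ⟨h1, aff_sup m n H hH _ (h1.submatrix _) h2 h3 h4⟩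

/-- combinatorial nonemptiness condition -/
def NE (n : ℕ) (H : ℕ → Type) : Prop :=
  ∀ k < n, (∀ j ≤ 2 * k, Nonempty (H j)) → Nonempty (H (2 * k + 1))

theorem psd_of_empty {Ω : Type*} [Fintype Ω] [IsEmpty Ω] (M : Matrix Ω Ω ℂ) : M.PosSemidef := by
  have : M = 0 := Subsingleton.elim _ _
  rw [this]; exact PosSemidef.zero

theorem NE_succ (n : ℕ) (H : ℕ → Type) (hd : ¬ ∀ j < 2 * (n + 2), Nonempty (H j)) :
    NE (n + 2) H ↔ IsEmpty (H 0) ∨ ¬ NE (n + 1) (fun j => H (j + 1)) := by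
  constructor
  · intro h
    by_contra! hc
    obtain ⟨h0, h1⟩ := hc
    have h0 : Nonempty (H 0) := h0
    apply hd
    intro j
    induction j using Nat.strong_induction_on with
    | _ j ih =>
      intro hj
      obtain ⟨k, rfl | rfl⟩ := Nat.even_or_odd' j
      · rcases k with _ | k
        · exact h0
        · exact h1 k (by omega) (fun i hi => ih (i + 1) (by omega) (by omega))
      · exact h k (by omega) (fun i hi => ih i (by omega) (by omega))
  · rintro (h | h) k hk hj
    · exact absurd (hj 0 (by omega)) (not_nonempty_iff.2 h)
    · unfold NE at h
      push Not at h
      obtain ⟨l, hl, h1, h2⟩ := h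
      by_cases hlk : k ≤ l
      · exact h1 (2 * k) (by omega)
      · exact absurd (hj (2 * l + 1 + 1) (by omega)) (by simpa using h2)

theorem pi_empty {q : ℕ} {H : ℕ → Type} (hd : ¬ ∀ j < q, Nonempty (H j)) :
    IsEmpty (∀ j : Fin q, H j) := by
  push Not at hd
  obtain ⟨j, hj, h⟩ := hd
  exact ⟨fun f => h.elim (f ⟨j, hj⟩)⟩

theorem comb_nonempty (n : ℕ) : ∀ (H : ℕ → Type) [∀ j, Fintype (H j)] [∀ j, DecidableEq (H j)],
    (Comb (n + 1) H).Nonempty ↔ NE (n + 1) H := by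
  induction n with
  | zero =>
    intro H _ _
    by_cases hH : ∀ j < 2 * (0 + 1), Nonempty (H j)
    · refine iff_of_true ?_ fun k hk _ => hH _ (by omega)
      obtain ⟨R, hR⟩ := good_exists _ H hH
      exact ⟨R, (comb_iff_good 0 H hH R).2 hR⟩
    · have he := pi_empty hH
      constructor
      · rintro ⟨R, -, hR⟩ k hk hj
        obtain rfl : k = 0 := by omega
        by_contra h1
        obtain ⟨a⟩ := hj 0 (by omega)
        have h1 : IsEmpty (H 1) := not_nonempty_iff.1 h1
        have := congrFun (congrFun hR ((Equiv.piUnique (fun j : Fin 1 => H j)).symm a))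
          ((Equiv.piUnique (fun j : Fin 1 => H j)).symm a)
        rw [one_apply_eq] at this
        unfold trLast at this
        rw [Finset.univ_eq_empty, Finset.sum_empty] at this
        exact zero_ne_one this
      · intro h
        refine ⟨0, PosSemidef.zero, ?_⟩
        have h0 : IsEmpty (H 0) := by
          by_contra h0
          rw [not_isEmpty_iff] at h0
          apply hH
          intro j hj
          have := h 0 (by omega) (fun j hj => by
            obtain rfl : j = 0 := by omega
            exact h0)
          obtain rfl | rfl : j = 0 ∨ j = 1 := by omega
          · exact h0
          · exact this
        ext f
        exact h0.elim (f 0)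
  | succ n ih =>
    intro H _ _
    by_cases hH : ∀ j < 2 * (n + 1 + 1), Nonempty (H j)
    · refine iff_of_true ?_ fun k hk _ => hH _ (by omega)
      obtain ⟨R, hR⟩ := good_exists _ H hH
      exact ⟨R, (comb_iff_good _ H hH R).2 hR⟩
    · have he := pi_empty hH
      rw [NE_succ n H hH, ← ih]
      have he' : IsEmpty (H 0 × (∀ j : Fin (2 * (n + 1)), H (j + 1)) × H (2 * (n + 1) + 1)) :=
        (splitEnds H (2 * (n + 1))).symm.isEmpty_congr.2 he
      constructor
      · rintro ⟨R, -, hR⟩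
        by_contra! hc
        obtain ⟨⟨a⟩, S, hS⟩ := hc
        have := congrFun (congrFun (hR S hS).2 a) a
        rw [one_apply_eq] at this
        unfold ptrMid at this
        rw [Finset.sum_eq_zero] at this
        · exact zero_ne_one this
        · intro c _
          apply Finset.sum_eq_zero
          intro b _
          exact he'.elim (a, b, c)
      · intro h
        refine ⟨0, PosSemidef.zero, fun S hS => ?_⟩
        rcases h with h | h
        · exact ⟨psd_of_empty _, by ext a; exact h.elim a⟩
        · exact absurd ⟨S, hS⟩ h

theorem comb_nonempty' (n : ℕ) (hn : 1 ≤ n) (H : ℕ → Type) [∀ j, Fintype (H j)]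
    [∀ j, DecidableEq (H j)] : (Comb n H).Nonempty ↔ NE n H := by
  obtain ⟨k, rfl⟩ : ∃ k, n = k + 1 := ⟨n - 1, by omega⟩
  exact comb_nonempty k H

theorem mem_of_subsing {α : Type*} [Subsingleton α] (s : Set α) (x : α) : x ∈ s ↔ s.Nonempty := by
  constructor
  · exact fun h => ⟨x, h⟩
  · rintro ⟨y, hy⟩
    rwa [Subsingleton.elim x y]

theorem extendPerm_tooth {p : ℕ} (σ : Equiv.Perm (Fin p)) (j : ℕ) (hj : j < 2 * p) :
    extendPerm (toothReorder σ) j = 2 * (σ.symm ⟨j / 2, by omega⟩ : ℕ) + j % 2 := by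
  rw [extendPerm, dif_pos hj]; rfl

theorem NE_shuf (m n : ℕ) (H : ℕ → Type) :
    (NE m H ∧ NE n (fun i => H (2 * m + i))) ↔
    ∀ σ, IsShuf m n σ → NE (m + n) (fun i => H (extendPerm (toothReorder σ) i)) := by
  constructor
  · rintro ⟨hA, hB⟩ σ hσ k hk h
    obtain ⟨t, ht⟩ : ∃ t, σ t = ⟨k, hk⟩ := ⟨σ.symm ⟨k, hk⟩, by simp⟩
    have ht2 : (σ t : ℕ) = k := by rw [ht]
    have ht' : ∀ hh, σ.symm ⟨(2 * k + 1) / 2, hh⟩ = t := by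
      intro hh
      rw [Equiv.symm_apply_eq, ht]
      apply Fin.ext; simp only []; omega
    have hpos : ∀ s : Fin (m + n), ∀ r < 2, 2 * (σ s : ℕ) + r ≤ 2 * k → Nonempty (H (2 * s + r)) := by
      intro s r hr hs
      have := h (2 * (σ s : ℕ) + r) hs
      have e : extendPerm (toothReorder σ) (2 * (σ s : ℕ) + r) = 2 * s + r := by
        rw [extendPerm_tooth _ _ (by omega)]
        have : (⟨(2 * (σ s : ℕ) + r) / 2, by omega⟩ : Fin (m + n)) = σ s :=
          Fin.ext (by simp only []; omega)
        rw [this, Equiv.symm_apply_apply]; omega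
      simp only [] at this
      rwa [e] at this
    show Nonempty (H (extendPerm (toothReorder σ) (2 * k + 1)))
    rw [extendPerm_tooth _ _ (by omega), ht', show (2 * k + 1) % 2 = 1 by omega]
    rcases lt_or_ge (t : ℕ) m with htm | htm
    · apply hA t htm
      intro j hj
      have := hpos ⟨j / 2, by omega⟩ (j % 2) (by omega) (by
        rcases Nat.lt_or_ge (j / 2) t with h1 | h1
        · have := hσ.1 ⟨j / 2, by omega⟩ t (by rw [Fin.lt_def]; exact h1) htm
          rw [Fin.lt_def] at this
          omega
        · have e : (⟨j / 2, by omega⟩ : Fin (m + n)) = t := Fin.ext (by simp only []; omega)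
          rw [e]; omega)
      simpa [Nat.div_add_mod] using this
    · have := hB (t - m) (by omega) (by
        intro j hj
        have := hpos ⟨(2 * m + j) / 2, by omega⟩ ((2 * m + j) % 2) (by omega) (by
          rcases Nat.lt_or_ge ((2 * m + j) / 2) t with h1 | h1
          · have := hσ.2 ⟨(2 * m + j) / 2, by omega⟩ t (by rw [Fin.lt_def]; exact h1) (by simp only []; omega)
            rw [Fin.lt_def] at this
            omega
          · have e : (⟨(2 * m + j) / 2, by omega⟩ : Fin (m + n)) = t := Fin.ext (by simp only []; omega)
            rw [e]; omega)
        simp only [Nat.div_add_mod] at this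
        exact this)
      simp only [] at this
      rwa [show 2 * m + (2 * ((t : ℕ) - m) + 1) = 2 * t + 1 by omega] at this
  · intro h
    constructor
    · have h1 := h _ (isShuf_one m n)
      intro k hk hj
      have e : ∀ j < 2 * (m + n), extendPerm (toothReorder (1 : Equiv.Perm (Fin (m + n)))) j = j := by
        intro j hj
        rw [extendPerm_tooth _ _ hj]
        show 2 * (j / 2) + j % 2 = j
        omega
      have := h1 k (by omega) (fun j hj' => by
        simp only []
        rw [e j (by omega)]; exact hj j hj')
      simp only [] at this
      rwa [e _ (by omega)] at this
    · have h1 := h _ (isShuf_sBA m n)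
      intro k hk hj
      have e : ∀ j < 2 * n, extendPerm (toothReorder (sBA m n)) j = 2 * m + j := by
        intro j hj
        rw [extendPerm_tooth _ _ (by omega)]
        have : (sBA m n).symm ⟨j / 2, by omega⟩ = ⟨m + j / 2, by omega⟩ := by
          rw [Equiv.symm_apply_eq]
          apply Fin.ext
          rw [sBA_ge _ _ _ (by simp)]
          simp
        rw [this]
        simp only []
        omega
      have := h1 k (by omega) (fun j hj' => by
        simp only []
        rw [e j (by omega)]; exact hj j hj')
      simp only [] at this
      rwa [e _ (by omega)] at this

theorem main_deg (m n : ℕ) (hm : 1 ≤ m) (hn : 1 ≤ n) (H : ℕ → Type)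
    [∀ j, Fintype (H j)] [∀ j, DecidableEq (H j)]
    (hH : ¬ ∀ j < 2 * m + 2 * n, Nonempty (H j))
    (R : Matrix (∀ j : Fin (2 * m + 2 * n), H j) (∀ j : Fin (2 * m + 2 * n), H j) ℂ) :
    (R.PosSemidef ∧
      Matrix.reindex (splitPi (2 * m) (2 * n) H) (splitPi (2 * m) (2 * n) H) R ∈
        affineSpan ℝ (Set.image2 (· ⊗ₖ ·) (Comb m H) (Comb n (fun i => H (2 * m + i))))) ↔
    ∀ σ, IsShuf m n σ → R ∈ Kset m n H σ := by
  have he := pi_empty hH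
  have hR := psd_of_empty R
  have he1 : IsEmpty ((∀ j : Fin (2 * m), H j) × (∀ j : Fin (2 * n), H (2 * m + j))) :=
    (splitPi (2 * m) (2 * n) H).symm.isEmpty_congr.2 he
  have hK : ∀ σ, R ∈ Kset m n H σ ↔ NE (m + n) (fun i => H (extendPerm (toothReorder σ) i)) := by
    intro σ
    have he2 : IsEmpty (∀ j : Fin (2 * (m + n)), H (extendPerm (toothReorder σ) j)) :=
      (Phi m n H σ).symm.isEmpty_congr.2 he
    rw [← comb_nonempty' _ (by omega)]
    refine Iff.trans (and_iff_right hR) ?_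
    exact mem_of_subsing _ _
  simp only [hK]
  rw [← NE_shuf, ← comb_nonempty' m hm, ← comb_nonempty' n hn, and_iff_right hR,
    ← Set.image2_nonempty_iff (f := (· ⊗ₖ ·)), ← affineSpan_nonempty ℝ]
  exact mem_of_subsing _ _

/-- the set of PSD operators on `H = A_0⊗⋯⊗A_{2m−1}⊗B_0⊗⋯⊗B_{2n−1}` lying
in the affine span (over ℝ) of `{M⊗N : M ∈ Comb_m(A…), N ∈ Comb_n(B…)}` equals the
intersection `⋂_{σ ∈ Σ_{m,n}} K_σ` over all shuffle permutations of the `m+n` teeth. -/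
theorem stmt_1 (m n : ℕ) (hm : 1 ≤ m) (hn : 1 ≤ n) (H : ℕ → Type)
    [∀ j, Fintype (H j)] [∀ j, DecidableEq (H j)] :
    {R : Matrix (∀ j : Fin (2 * m + 2 * n), H j) (∀ j : Fin (2 * m + 2 * n), H j) ℂ |
      R.PosSemidef ∧
      Matrix.reindex (splitPi (2 * m) (2 * n) H) (splitPi (2 * m) (2 * n) H) R ∈
        affineSpan ℝ (Set.image2 (· ⊗ₖ ·) (Comb m H) (Comb n (fun i => H (2 * m + i))))} =
      ⋂ σ ∈ {σ : Equiv.Perm (Fin (m + n)) |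
          (∀ i j : Fin (m + n), i < j → (j : ℕ) < m → σ i < σ j) ∧
          (∀ i j : Fin (m + n), i < j → m ≤ (i : ℕ) → σ i < σ j)},
        Kset m n H σ := by
  ext R
  rw [Set.mem_iInter₂]
  by_cases hH : ∀ j < 2 * m + 2 * n, Nonempty (H j)
  · exact main_nondeg m n hm hn H hH R
  · exact main_deg m n hm hn H hH R

end
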